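/- For the natural representation of sl₃(ℂ) on the free Lie algebra L on a, b, c, the space of Lie invariants of degree 12 has dimension 35, and every Lie invariant of degree 12 is primitive. -/

import Mathlib

/-!
Setting: the free Lie algebra `FL` over ℂ on three generators `a < b < c`, with the
simple Lie algebra sl₃(ℂ) of traceless 3×3 complex matrices (standard basis
x₁ = E₁₂, x₂ = E₂₃, x₃ = E₁₃, h₁ = E₁₁−E₂₂, h₂ = E₂₂−E₃₃, y₁ = E₂₁, y₂ = E₃₂,
y₃ = E₃₁) acting on `FL` by derivations extending its natural representation on the
span of the generators (a, b, c are the standard basis column vectors e₁, e₂, e₃,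
acted on by matrix-vector multiplication):  x₁.b = a, x₂.c = b, x₃.c = a, h₁.a = a,
h₁.b = −b, h₂.b = b, h₂.c = −c, y₁.a = b, y₂.b = c, y₃.a = c, and all other actions of
these basis elements on the generators are zero.  The derivations realizing these
actions are determined by their values on the generators, so we quantify over
derivations with the prescribed generator values.
-/

noncomputable section

/-- The free Lie algebra over ℂ on three generators. -/
abbrev FL : Type := FreeLieAlgebra ℂ (Fin 3)

/-- The generator `a`. -/
def genA : FL := FreeLieAlgebra.of ℂ 0

/-- The generator `b`. -/
def genB : FL := FreeLieAlgebra.of ℂ 1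

/-- The generator `c`. -/
def genC : FL := FreeLieAlgebra.of ℂ 2

/-- Interpret a nonassociative word on the generators as a Lie monomial in `FL`. -/
def magmaToLie : FreeMagma (Fin 3) → FL
  | .of i => FreeLieAlgebra.of ℂ i
  | .mul t u => ⁅magmaToLie t, magmaToLie u⁆

/-- The homogeneous component `L_j`: the span of the Lie monomials of degree `j`. -/
def homog (j : ℕ) : Submodule ℂ FL :=
  Submodule.span ℂ (magmaToLie '' {t | t.length = j})

/-- The weight space `L_j^(w₁,w₂)`: the joint eigenspace of the `h₁`- and `h₂`-actions
on `L_j` with eigenvalues `w₁` and `w₂` respectively. -/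
def wtsp2 (H1 H2 : LieDerivation ℂ FL FL) (j : ℕ) (w1 w2 : ℤ) : Submodule ℂ FL :=
  homog j ⊓ Module.End.eigenspace (H1.toLinearMap) (w1 : ℂ) ⊓
    Module.End.eigenspace (H2.toLinearMap) (w2 : ℂ)

/-- The space of Lie invariants of degree `j`: elements of `L_j` annihilated by every
element of sl₃(ℂ), equivalently by the actions of the eight standard basis elements. -/
def invariants3 (X1 X2 X3 H1 H2 Y1 Y2 Y3 : LieDerivation ℂ FL FL) (j : ℕ) :
    Submodule ℂ FL :=
  homog j ⊓ LinearMap.ker X1.toLinearMap ⊓ LinearMap.ker X2.toLinearMap ⊓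
    LinearMap.ker X3.toLinearMap ⊓ LinearMap.ker H1.toLinearMap ⊓
    LinearMap.ker H2.toLinearMap ⊓ LinearMap.ker Y1.toLinearMap ⊓
    LinearMap.ker Y2.toLinearMap ⊓ LinearMap.ker Y3.toLinearMap

/-- The Lie subalgebra of `FL` generated by the invariants of degree `< j`.
An invariant of degree `j` is primitive iff it does not belong to this subalgebra. -/
def lowerInv3 (X1 X2 X3 H1 H2 Y1 Y2 Y3 : LieDerivation ℂ FL FL) (j : ℕ) :
    LieSubalgebra ℂ FL :=
  LieSubalgebra.lieSpan ℂ FL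
    (⋃ i < j, (invariants3 X1 X2 X3 H1 H2 Y1 Y2 Y3 i : Set FL))


namespace SL

lemma weight_bound {M : Type*} [AddCommGroup M] [Module ℂ M] [FiniteDimensional ℂ M]
    (H : Module.End ℂ M) : ∃ N : ℤ, ∀ m : ℤ, N < m → ∀ v : M, H v = (m : ℂ) • v → v = 0 := by
  have hf : {m : ℤ | H.HasEigenvalue (m : ℂ)}.Finite := by
    have h1 := Module.End.finite_hasEigenvalue H
    exact h1.preimage (Int.cast_injective.injOn)
  obtain ⟨N, hN⟩ := hf.bddAbove
  refine ⟨N, fun m hm v hv => ?_⟩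
  by_contra hne
  have : m ∈ {m : ℤ | H.HasEigenvalue (m : ℂ)} :=
    Module.End.hasEigenvalue_of_hasEigenvector ⟨Module.End.mem_eigenspace_iff.2 hv, hne⟩
  exact absurd (hN this) (by omega)

/-- The key sl₂ lemma: `X Y` is injective on positive weight spaces. -/
lemma sl2_key {M : Type*} [AddCommGroup M] [Module ℂ M] [FiniteDimensional ℂ M]
    (X Y H : Module.End ℂ M)
    (hxy : ∀ v, X (Y v) = Y (X v) + H v) (hhx : ∀ v, H (X v) = X (H v) + (2 : ℂ) • X v)
    (m : ℤ) (hm : 1 ≤ m) (v : M) (hv : H v = (m : ℂ) • v) (h0 : X (Y v) = 0) : v = 0 := by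
  obtain ⟨N, hN⟩ := weight_bound H
  have key : ∀ t : ℕ, ∀ p : ℤ, m ≤ p → N < p + t → ∀ u : M, H u = (p : ℂ) • u →
      (4 : ℂ) • Y (X u) = ((m * (m - 2) - p * (p + 2) : ℤ) : ℂ) • u → u = 0 := by
    intro t
    induction t with
    | zero => intro p _ hp u hu _; exact hN p (by simpa using hp) u hu
    | succ t ih =>
      intro p hmp hp u hu hc
      have hXu : X u = 0 := by
        apply ih (p + 2) (by omega) (by push_cast at hp ⊢; omega)
        · rw [hhx, hu, map_smul, ← add_smul]; push_cast; rfl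
        · have h1 : X ((4 : ℂ) • Y (X u)) = X (((m * (m - 2) - p * (p + 2) : ℤ) : ℂ) • u) := by
            rw [hc]
          rw [map_smul, map_smul, hxy, hhx, hu, map_smul] at h1
          have h2 : (4 : ℂ) • Y (X (X u)) =
              ((m * (m - 2) - p * (p + 2) : ℤ) : ℂ) • X u - (4 : ℂ) • ((p : ℂ) • X u + (2 : ℂ) • X u) := by
            rw [← h1]; module
          rw [h2]; push_cast; module
      rw [hXu, map_zero, smul_zero] at hc
      rcases smul_eq_zero.1 hc.symm with h | h
      · exfalso
        have h' : m * (m - 2) - p * (p + 2) = 0 := by exact_mod_cast h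
        nlinarith
      · exact h
  refine key (N + 1 - m).toNat m le_rfl (by omega) v hv ?_
  rw [hxy, hv] at h0
  have : Y (X v) = - ((m : ℂ) • v) := eq_neg_of_add_eq_zero_left h0
  rw [this]; push_cast; module

/-- The commutation relations of sl₃. -/
structure Rel {M : Type*} [AddCommGroup M] [Module ℂ M]
    (X1 X2 X3 H1 H2 Y1 Y2 Y3 : Module.End ℂ M) : Prop where
  x12 : ∀ v, X1 (X2 v) = X2 (X1 v) + X3 v
  x13 : ∀ v, X1 (X3 v) = X3 (X1 v)
  x23 : ∀ v, X2 (X3 v) = X3 (X2 v)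
  y12 : ∀ v, Y1 (Y2 v) = Y2 (Y1 v) - Y3 v
  y13 : ∀ v, Y1 (Y3 v) = Y3 (Y1 v)
  y23 : ∀ v, Y2 (Y3 v) = Y3 (Y2 v)
  x1y1 : ∀ v, X1 (Y1 v) = Y1 (X1 v) + H1 v
  x2y2 : ∀ v, X2 (Y2 v) = Y2 (X2 v) + H2 v
  x3y3 : ∀ v, X3 (Y3 v) = Y3 (X3 v) + (H1 v + H2 v)
  x1y2 : ∀ v, X1 (Y2 v) = Y2 (X1 v)
  x2y1 : ∀ v, X2 (Y1 v) = Y1 (X2 v)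
  x1y3 : ∀ v, X1 (Y3 v) = Y3 (X1 v) - Y2 v
  x2y3 : ∀ v, X2 (Y3 v) = Y3 (X2 v) + Y1 v
  x3y1 : ∀ v, X3 (Y1 v) = Y1 (X3 v) - X2 v
  x3y2 : ∀ v, X3 (Y2 v) = Y2 (X3 v) + X1 v
  h1x1 : ∀ v, H1 (X1 v) = X1 (H1 v) + (2 : ℂ) • X1 v
  h1x2 : ∀ v, H1 (X2 v) = X2 (H1 v) - X2 v
  h1x3 : ∀ v, H1 (X3 v) = X3 (H1 v) + X3 v
  h2x1 : ∀ v, H2 (X1 v) = X1 (H2 v) - X1 v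
  h2x2 : ∀ v, H2 (X2 v) = X2 (H2 v) + (2 : ℂ) • X2 v
  h2x3 : ∀ v, H2 (X3 v) = X3 (H2 v) + X3 v
  h1y1 : ∀ v, H1 (Y1 v) = Y1 (H1 v) - (2 : ℂ) • Y1 v
  h1y2 : ∀ v, H1 (Y2 v) = Y2 (H1 v) + Y2 v
  h1y3 : ∀ v, H1 (Y3 v) = Y3 (H1 v) - Y3 v
  h2y1 : ∀ v, H2 (Y1 v) = Y1 (H2 v) + Y1 v
  h2y2 : ∀ v, H2 (Y2 v) = Y2 (H2 v) - (2 : ℂ) • Y2 v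
  h2y3 : ∀ v, H2 (Y3 v) = Y3 (H2 v) - Y3 v

/-- The joint weight space. -/
def wt {M : Type*} [AddCommGroup M] [Module ℂ M] (H1 H2 : Module.End ℂ M) (a b : ℤ) :
    Submodule ℂ M := Module.End.eigenspace H1 (a : ℂ) ⊓ Module.End.eigenspace H2 (b : ℂ)

lemma mem_wt {M : Type*} [AddCommGroup M] [Module ℂ M] {H1 H2 : Module.End ℂ M} {a b : ℤ} {v : M} :
    v ∈ wt H1 H2 a b ↔ H1 v = (a : ℂ) • v ∧ H2 v = (b : ℂ) • v := by
  simp [wt]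

section
variable {M : Type*} [AddCommGroup M] [Module ℂ M]
    {X1 X2 X3 H1 H2 Y1 Y2 Y3 : Module.End ℂ M}

/-- Half of the Casimir on a weight space. -/
noncomputable def kap (X1 X2 X3 Y1 Y2 Y3 : Module.End ℂ M) (a b : ℤ) : Module.End ℂ M :=
  (((a ^ 2 + a * b + b ^ 2) / 3 + a + b : ℂ)) • LinearMap.id
    + Y1 * X1 + Y2 * X2 + Y3 * X3

lemma kap_apply (a b : ℤ) (v : M) : kap X1 X2 X3 Y1 Y2 Y3 a b v =
    (((a ^ 2 + a * b + b ^ 2) / 3 + a + b : ℂ)) • v + Y1 (X1 v) + Y2 (X2 v) + Y3 (X3 v) := rfl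

namespace Rel
variable (R : Rel X1 X2 X3 H1 H2 Y1 Y2 Y3)
include R

lemma X1_mem {a b : ℤ} {v : M} (hv : v ∈ wt H1 H2 a b) : X1 v ∈ wt H1 H2 (a + 2) (b - 1) := by
  rw [mem_wt] at hv ⊢
  rw [R.h1x1, R.h2x1, hv.1, hv.2, map_smul, map_smul]
  constructor <;> (push_cast; module)

lemma X2_mem {a b : ℤ} {v : M} (hv : v ∈ wt H1 H2 a b) : X2 v ∈ wt H1 H2 (a - 1) (b + 2) := by
  rw [mem_wt] at hv ⊢
  rw [R.h1x2, R.h2x2, hv.1, hv.2, map_smul, map_smul]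
  constructor <;> (push_cast; module)

lemma X3_mem {a b : ℤ} {v : M} (hv : v ∈ wt H1 H2 a b) : X3 v ∈ wt H1 H2 (a + 1) (b + 1) := by
  rw [mem_wt] at hv ⊢
  rw [R.h1x3, R.h2x3, hv.1, hv.2, map_smul, map_smul]
  constructor <;> (push_cast; module)

lemma Y1_mem {a b : ℤ} {v : M} (hv : v ∈ wt H1 H2 a b) : Y1 v ∈ wt H1 H2 (a - 2) (b + 1) := by
  rw [mem_wt] at hv ⊢
  rw [R.h1y1, R.h2y1, hv.1, hv.2, map_smul, map_smul]
  constructor <;> (push_cast; module)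

lemma Y2_mem {a b : ℤ} {v : M} (hv : v ∈ wt H1 H2 a b) : Y2 v ∈ wt H1 H2 (a + 1) (b - 2) := by
  rw [mem_wt] at hv ⊢
  rw [R.h1y2, R.h2y2, hv.1, hv.2, map_smul, map_smul]
  constructor <;> (push_cast; module)

lemma Y3_mem {a b : ℤ} {v : M} (hv : v ∈ wt H1 H2 a b) : Y3 v ∈ wt H1 H2 (a - 1) (b - 1) := by
  rw [mem_wt] at hv ⊢
  rw [R.h1y3, R.h2y3, hv.1, hv.2, map_smul, map_smul]
  constructor <;> (push_cast; module)

lemma kap_X1 {a b : ℤ} {v : M} (hv : v ∈ wt H1 H2 a b) :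
    kap X1 X2 X3 Y1 Y2 Y3 (a + 2) (b - 1) (X1 v) = X1 (kap X1 X2 X3 Y1 Y2 Y3 a b v) := by
  rw [mem_wt] at hv
  simp only [kap_apply, map_add, map_smul, R.x1y1, R.x1y2, R.x1y3, R.x12, R.x13, R.h1x1, hv.1]
  push_cast; module

lemma kap_X2 {a b : ℤ} {v : M} (hv : v ∈ wt H1 H2 a b) :
    kap X1 X2 X3 Y1 Y2 Y3 (a - 1) (b + 2) (X2 v) = X2 (kap X1 X2 X3 Y1 Y2 Y3 a b v) := by
  rw [mem_wt] at hv
  simp only [kap_apply, map_add, map_smul, R.x2y1, R.x2y2, R.x2y3, R.x12, R.x23, R.h2x2, hv.2]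
  push_cast; module

lemma kap_X3 {a b : ℤ} {v : M} (hv : v ∈ wt H1 H2 a b) :
    kap X1 X2 X3 Y1 Y2 Y3 (a + 1) (b + 1) (X3 v) = X3 (kap X1 X2 X3 Y1 Y2 Y3 a b v) := by
  rw [mem_wt] at hv
  simp only [kap_apply, map_add, map_smul, R.x3y1, R.x3y2, R.x3y3, R.x12, R.x13, R.x23, R.h1x3,
    R.h2x3, hv.1, hv.2]
  push_cast; module

lemma kap_Y1 {a b : ℤ} {v : M} (hv : v ∈ wt H1 H2 a b) :
    kap X1 X2 X3 Y1 Y2 Y3 (a - 2) (b + 1) (Y1 v) = Y1 (kap X1 X2 X3 Y1 Y2 Y3 a b v) := by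
  rw [mem_wt] at hv
  simp only [kap_apply, map_add, map_smul, map_sub, R.x1y1, R.x2y1, R.x3y1, R.y12, R.y13, hv.1]
  push_cast; module

variable [FiniteDimensional ℂ M]

lemma inj_X1Y1 {a b : ℤ} (ha : 1 ≤ a) {v : M} (hv : v ∈ wt H1 H2 a b) (h : X1 (Y1 v) = 0) :
    v = 0 :=
  sl2_key X1 Y1 H1 R.x1y1 R.h1x1 a ha v (mem_wt.1 hv).1 h

lemma inj_X1 {a b : ℤ} (ha : a ≤ -1) {v : M} (hv : v ∈ wt H1 H2 a b) (h : X1 v = 0) :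
    v = 0 := by
  refine sl2_key Y1 X1 (-H1) ?_ ?_ (-a) (by omega) v ?_ (by rw [h, map_zero])
  · intro v; rw [R.x1y1]; simp
  · intro v; simp only [LinearMap.neg_apply, map_neg, R.h1y1]; module
  · simp only [LinearMap.neg_apply, (mem_wt.1 hv).1]; push_cast; module

lemma inj_X2 {a b : ℤ} (hb : b ≤ -1) {v : M} (hv : v ∈ wt H1 H2 a b) (h : X2 v = 0) :
    v = 0 := by
  refine sl2_key Y2 X2 (-H2) ?_ ?_ (-b) (by omega) v ?_ (by rw [h, map_zero])
  · intro v; rw [R.x2y2]; simp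
  · intro v; simp only [LinearMap.neg_apply, map_neg, R.h2y2]; module
  · simp only [LinearMap.neg_apply, (mem_wt.1 hv).2]; push_cast; module

lemma kap_inj {a b : ℤ} (hab : 1 ≤ a + b) {v : M} (hv : v ∈ wt H1 H2 a b)
    (h : kap X1 X2 X3 Y1 Y2 Y3 a b v = 0) : v = 0 := by
  obtain ⟨N, hN⟩ := weight_bound (H1 + H2)
  have key : ∀ t : ℕ, ∀ a b : ℤ, 1 ≤ a + b → N < a + b + t → ∀ v ∈ wt H1 H2 a b,
      kap X1 X2 X3 Y1 Y2 Y3 a b v = 0 → v = 0 := by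
    intro t
    induction t with
    | zero =>
      intro a b _ hp v hv _
      refine hN (a + b) (by simpa using hp) v ?_
      rw [LinearMap.add_apply, (mem_wt.1 hv).1, (mem_wt.1 hv).2]; push_cast; module
    | succ t ih =>
      intro a b hab hp v hv h
      have h1 : X1 v = 0 := ih _ _ (by omega) (by push_cast at hp; omega) _ (R.X1_mem hv)
        (by rw [R.kap_X1 hv, h, map_zero])
      have h2 : X2 v = 0 := ih _ _ (by omega) (by push_cast at hp; omega) _ (R.X2_mem hv)
        (by rw [R.kap_X2 hv, h, map_zero])
      have h3 : X3 v = 0 := by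
        have := R.x12 v
        rw [h1, h2] at this; simpa using this.symm
      by_contra hne
      have ha : 0 ≤ a := by
        by_contra hlt; exact hne (R.inj_X1 (by omega) hv h1)
      have hb : 0 ≤ b := by
        by_contra hlt; exact hne (R.inj_X2 (by omega) hv h2)
      rw [kap_apply, h1, h2, h3] at h
      simp only [map_zero, add_zero] at h
      rcases smul_eq_zero.1 h with h | h
      · have h' : ((a ^ 2 + a * b + b ^ 2 + 3 * a + 3 * b : ℤ) : ℂ) = 0 := by
          push_cast; linear_combination 3 * h
        have h'' : (a ^ 2 + a * b + b ^ 2 + 3 * a + 3 * b : ℤ) = 0 := by exact_mod_cast h'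
        nlinarith [mul_nonneg ha hb, sq_nonneg a, sq_nonneg b]
      · exact hne h
  exact key (N + 1 - (a + b)).toNat a b hab (by omega) v hv h

end Rel

lemma surj_of_inj [FiniteDimensional ℂ M] (f : Module.End ℂ M) (P : Submodule ℂ M)
    (hm : ∀ v ∈ P, f v ∈ P) (hi : ∀ v ∈ P, f v = 0 → v = 0) : ∀ v ∈ P, ∃ u ∈ P, f u = v := by
  have hinj : Function.Injective (f.restrict hm) := by
    rw [← LinearMap.ker_eq_bot, LinearMap.ker_eq_bot']
    rintro ⟨v, hv⟩ h
    have h' : f v = 0 := by simpa using congrArg Subtype.val h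
    exact Subtype.ext (hi v hv h')
  have hs := LinearMap.surjective_of_injective hinj
  intro v hv
  obtain ⟨u, hu⟩ := hs ⟨v, hv⟩
  exact ⟨u, u.2, by simpa using congrArg Subtype.val hu⟩

lemma rank_null [FiniteDimensional ℂ M] (f : Module.End ℂ M) (P : Submodule ℂ M) :
    Module.finrank ℂ (P.map f) + Module.finrank ℂ (P ⊓ LinearMap.ker f : Submodule ℂ M) =
      Module.finrank ℂ P := by
  have h := LinearMap.finrank_range_add_finrank_ker (f.domRestrict P)
  rw [LinearMap.range_domRestrict] at h
  rw [← h]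
  congr 1
  have e := Submodule.finrank_map_subtype_eq P (LinearMap.ker (f.domRestrict P))
  rw [← e]
  have : Submodule.map P.subtype (LinearMap.ker (f.domRestrict P)) = P ⊓ LinearMap.ker f := by
    ext v; simp [LinearMap.mem_ker, and_comm]
  rw [this]

namespace Rel
variable (R : Rel X1 X2 X3 H1 H2 Y1 Y2 Y3) [FiniteDimensional ℂ M]
include R

lemma finrank_K (a b : ℤ) (ha : -1 ≤ a) :
    Module.finrank ℂ (wt H1 H2 (a + 2) (b - 1)) +
      Module.finrank ℂ (wt H1 H2 a b ⊓ LinearMap.ker X1 : Submodule ℂ M) =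
      Module.finrank ℂ (wt H1 H2 a b) := by
  rw [← rank_null X1 (wt H1 H2 a b)]
  have : Submodule.map X1 (wt H1 H2 a b) = wt H1 H2 (a + 2) (b - 1) := by
    apply le_antisymm
    · rintro _ ⟨v, hv, rfl⟩; exact R.X1_mem hv
    · intro v hv
      have hY : ∀ u ∈ wt H1 H2 (a + 2) (b - 1), Y1 u ∈ wt H1 H2 a b := by
        intro u hu
        have := R.Y1_mem hu
        rwa [show a + 2 - 2 = a by ring, show b - 1 + 1 = b by ring] at this
      obtain ⟨u, hu, h⟩ := surj_of_inj (X1 * Y1) (wt H1 H2 (a + 2) (b - 1))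
        (fun u hu => R.X1_mem (hY u hu))
        (fun u hu h => R.inj_X1Y1 (by omega) hu h) v hv
      exact ⟨Y1 u, hY u hu, h⟩
  rw [this]

/-- The invariants inside `M`. -/
lemma inv_eq : (wt H1 H2 0 0 ⊓ LinearMap.ker X1) ⊓ LinearMap.ker X3 =
    LinearMap.ker X1 ⊓ LinearMap.ker X2 ⊓ LinearMap.ker X3 ⊓ LinearMap.ker H1 ⊓
    LinearMap.ker H2 ⊓ LinearMap.ker Y1 ⊓ LinearMap.ker Y2 ⊓ LinearMap.ker Y3 := by
  ext v
  simp only [Submodule.mem_inf, LinearMap.mem_ker]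
  constructor
  · rintro ⟨⟨hv, h1⟩, h3⟩
    have e := mem_wt.1 hv
    simp only [Int.cast_zero, zero_smul] at e
    have y1 : Y1 v = 0 := R.inj_X1 (by norm_num) (R.Y1_mem hv) (by rw [R.x1y1, h1, e.1]; simp)
    have h2 : X2 v = 0 := by
      have := R.x3y1 v
      rw [y1, h3] at this; simpa using this
    have y2 : Y2 v = 0 := R.inj_X2 (by norm_num) (R.Y2_mem hv) (by rw [R.x2y2, h2, e.2]; simp)
    have y3 : Y3 v = 0 := by
      have := R.y12 v
      rw [y1, y2] at this; simpa using this
    exact ⟨⟨⟨⟨⟨⟨⟨h1, h2⟩, h3⟩, e.1⟩, e.2⟩, y1⟩, y2⟩, y3⟩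
  · rintro ⟨⟨⟨⟨⟨⟨⟨h1, h2⟩, h3⟩, e1⟩, e2⟩, y1⟩, y2⟩, y3⟩
    exact ⟨⟨mem_wt.2 (by simp [e1, e2]), h1⟩, h3⟩

lemma euler : Module.finrank ℂ (wt H1 H2 0 0 ⊓ LinearMap.ker X1 : Submodule ℂ M) +
    Module.finrank ℂ (wt H1 H2 0 3 ⊓ LinearMap.ker X1 : Submodule ℂ M) =
    Module.finrank ℂ ((wt H1 H2 0 0 ⊓ LinearMap.ker X1) ⊓ LinearMap.ker X3 : Submodule ℂ M) +
    Module.finrank ℂ (wt H1 H2 1 1 ⊓ LinearMap.ker X1 : Submodule ℂ M) := by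
  set K0 := wt H1 H2 0 0 ⊓ LinearMap.ker X1 with hK0
  set K1 := wt H1 H2 1 1 ⊓ LinearMap.ker X1 with hK1
  set K2 := wt H1 H2 0 3 ⊓ LinearMap.ker X1 with hK2
  set Z : Module.End ℂ M := (2 : ℂ) • X2 - Y1 * X3 with hZ
  have Zap : ∀ v, Z v = (2 : ℂ) • X2 v - Y1 (X3 v) := fun v => rfl
  have hy0 : ∀ b : ℤ, ∀ v ∈ wt H1 H2 0 b ⊓ LinearMap.ker X1, Y1 v = 0 := by
    rintro b v ⟨hv, h1⟩
    have h1' : X1 v = 0 := h1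
    exact R.inj_X1 (by norm_num) (R.Y1_mem hv) (by rw [R.x1y1, h1', (mem_wt.1 hv).1]; simp)
  -- the maps
  have d0 : ∀ v ∈ K0, X3 v ∈ K1 := by
    rintro v ⟨hv, h1⟩
    have h1' : X1 v = 0 := h1
    refine ⟨by simpa using R.X3_mem hv, ?_⟩
    change X1 (X3 v) = 0
    rw [R.x13, h1', map_zero]
  have d0z : ∀ v ∈ K0, Z (X3 v) = 0 := by
    intro v hv
    have y1 := hy0 0 v hv
    have e := R.x3y1 (X3 v)
    have e2 := R.x3y1 v
    rw [y1, map_zero] at e2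
    have e3 : Y1 (X3 v) = X2 v := by rw [eq_comm, sub_eq_zero] at e2; exact e2
    rw [e3] at e
    rw [Zap, R.x23]
    rw [R.x23] at e
    rw [show Y1 (X3 (X3 v)) = X3 (X2 v) + X3 (X2 v) from by rw [sub_eq_iff_eq_add.1 e.symm]]
    module
  have d1 : ∀ v ∈ K1, Z v ∈ K2 := by
    rintro v ⟨hv, h1⟩
    have h1' : X1 v = 0 := h1
    have hw := mem_wt.1 hv
    refine ⟨?_, ?_⟩
    · rw [Zap]
      refine sub_mem (Submodule.smul_mem _ _ ?_) ?_
      · simpa using R.X2_mem hv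
      · simpa using R.Y1_mem (R.X3_mem hv)
    · change X1 (Z v) = 0
      rw [Zap]
      simp only [map_sub, map_smul, R.x12, R.x1y1, R.x13, R.h1x3, h1', hw.1, map_zero]
      push_cast; module
  have s1 : ∀ v ∈ K1, Y3 v + Y2 (Y1 v) ∈ K0 := by
    rintro v ⟨hv, h1⟩
    have h1' : X1 v = 0 := h1
    have hw := mem_wt.1 hv
    refine ⟨add_mem ?_ ?_, ?_⟩
    · simpa using R.Y3_mem hv
    · simpa using R.Y2_mem (R.Y1_mem hv)
    · change X1 _ = 0
      simp only [map_add, R.x1y3, R.x1y2, R.x1y1, h1', hw.1, map_zero, map_smul]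
      push_cast; module
  have s2 : ∀ v ∈ K2, Y2 v ∈ K1 := by
    rintro v ⟨hv, h1⟩
    have h1' : X1 v = 0 := h1
    refine ⟨by simpa using R.Y2_mem hv, ?_⟩
    change X1 (Y2 v) = 0
    rw [R.x1y2, h1', map_zero]
  have hom2 : ∀ v ∈ K2, Z (Y2 v) = kap X1 X2 X3 Y1 Y2 Y3 0 3 v := by
    intro v hv
    have y1 := hy0 3 v hv
    obtain ⟨hv, h1⟩ := hv
    have h1' : X1 v = 0 := h1
    have hw := mem_wt.1 hv
    have e2 := R.x3y1 v
    rw [y1, map_zero] at e2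
    have e3 : Y1 (X3 v) = X2 v := by rw [eq_comm, sub_eq_zero] at e2; exact e2
    rw [Zap, kap_apply]
    simp only [R.x2y2, R.x3y2, h1', map_add, map_zero, R.y12, e3, hw.2]
    push_cast; module
  have hom1 : ∀ v ∈ K1, X3 (Y3 v + Y2 (Y1 v)) + Y2 (Z v) = kap X1 X2 X3 Y1 Y2 Y3 1 1 v := by
    rintro v ⟨hv, h1⟩
    have h1' : X1 v = 0 := h1
    have hw := mem_wt.1 hv
    rw [Zap, kap_apply]
    simp only [map_add, map_sub, map_smul, R.x3y3, R.x3y2, R.x3y1, R.x1y1, h1', map_zero, hw.1, hw.2]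
    push_cast; module
  -- Casimir on K1, K2
  have kX1 : ∀ a b : ℤ, ∀ v ∈ wt H1 H2 a b ⊓ LinearMap.ker X1,
      kap X1 X2 X3 Y1 Y2 Y3 a b v ∈ wt H1 H2 a b ⊓ LinearMap.ker X1 := by
    rintro a b v ⟨hv, h1⟩
    have h1' : X1 v = 0 := h1
    refine ⟨?_, ?_⟩
    · rw [kap_apply]
      refine add_mem (add_mem (add_mem (Submodule.smul_mem _ _ hv) ?_) ?_) ?_
      · simpa using R.Y1_mem (R.X1_mem hv)
      · simpa using R.Y2_mem (R.X2_mem hv)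
      · simpa using R.Y3_mem (R.X3_mem hv)
    · change X1 _ = 0
      rw [← R.kap_X1 hv, h1', map_zero]
  have sK1 : ∀ v ∈ K1, ∃ u ∈ K1, kap X1 X2 X3 Y1 Y2 Y3 1 1 u = v :=
    surj_of_inj _ K1 (kX1 1 1) (fun v hv h => R.kap_inj (by norm_num) hv.1 h)
  have sK2 : ∀ v ∈ K2, ∃ u ∈ K2, kap X1 X2 X3 Y1 Y2 Y3 0 3 u = v :=
    surj_of_inj _ K2 (kX1 0 3) (fun v hv h => R.kap_inj (by norm_num) hv.1 h)
  have kZ : ∀ v ∈ K1, kap X1 X2 X3 Y1 Y2 Y3 0 3 (Z v) = Z (kap X1 X2 X3 Y1 Y2 Y3 1 1 v) := by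
    rintro v ⟨hv, h1⟩
    have e1 := R.kap_X2 hv
    have e2 := R.kap_X3 hv
    have e3 := R.kap_Y1 (R.X3_mem hv)
    norm_num at e1 e2 e3
    rw [Zap, Zap, map_sub, map_smul, e1, e3, e2]
  have m1 : K1.map Z = K2 := by
    apply le_antisymm
    · rintro _ ⟨v, hv, rfl⟩; exact d1 v hv
    · intro v hv
      obtain ⟨u, hu, rfl⟩ := sK2 v hv
      exact ⟨Y2 u, s2 u hu, hom2 u hu⟩
  have m0 : K0.map X3 = K1 ⊓ LinearMap.ker Z := by
    apply le_antisymm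
    · rintro _ ⟨v, hv, rfl⟩; exact ⟨d0 v hv, d0z v hv⟩
    · rintro v ⟨hv, hz⟩
      have hz' : Z v = 0 := hz
      obtain ⟨u, hu, rfl⟩ := sK1 v hv
      have hzu : Z u = 0 := by
        refine R.kap_inj (a := 0) (b := 3) (by norm_num) (d1 u hu).1 ?_
        rw [kZ u hu, hz']
      have := hom1 u hu
      rw [hzu, map_zero, add_zero] at this
      exact ⟨_, s1 u hu, this⟩
  have r1 := rank_null Z K1
  have r0 := rank_null X3 K0
  rw [m1] at r1
  rw [m0] at r0
  omega

/-- The Weyl-type dimension formula for the invariants. -/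
theorem finrank_inv :
    (Module.finrank ℂ (LinearMap.ker X1 ⊓ LinearMap.ker X2 ⊓ LinearMap.ker X3 ⊓ LinearMap.ker H1 ⊓
      LinearMap.ker H2 ⊓ LinearMap.ker Y1 ⊓ LinearMap.ker Y2 ⊓ LinearMap.ker Y3 : Submodule ℂ M) : ℤ)
    = Module.finrank ℂ (wt H1 H2 0 0) - Module.finrank ℂ (wt H1 H2 2 (-1))
      - Module.finrank ℂ (wt H1 H2 1 1) + Module.finrank ℂ (wt H1 H2 3 0)
      + Module.finrank ℂ (wt H1 H2 0 3) - Module.finrank ℂ (wt H1 H2 2 2) := by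
  rw [← R.inv_eq]
  have h := R.euler
  have a0 := R.finrank_K 0 0 (by norm_num)
  have a1 := R.finrank_K 1 1 (by norm_num)
  have a2 := R.finrank_K 0 3 (by norm_num)
  rw [show (0 : ℤ) + 2 = 2 by norm_num, show (0 : ℤ) - 1 = -1 by norm_num] at a0
  rw [show (1 : ℤ) + 2 = 3 by norm_num, show (1 : ℤ) - 1 = 0 by norm_num] at a1
  rw [show (0 : ℤ) + 2 = 2 by norm_num, show (3 : ℤ) - 1 = 2 by norm_num] at a2
  omega

end Rel
end
end SL

namespace SL

attribute [local instance] LieRing.ofAssociativeRing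

/-- The free associative algebra, as a monoid algebra. -/
abbrev A : Type := MonoidAlgebra ℂ (FreeMonoid (Fin 3))

/-- The word `l` as an element of `A`. -/
def e (l : List (Fin 3)) : A := MonoidAlgebra.single (FreeMonoid.ofList l) 1

lemma e_mul (l l' : List (Fin 3)) : e l * e l' = e (l ++ l') := by
  simp [e, MonoidAlgebra.single_mul_single, FreeMonoid.ofList_append]

/-- Coefficient of a word. -/
def cf (l : List (Fin 3)) : A →ₗ[ℂ] ℂ :=
  (Finsupp.lapply (FreeMonoid.ofList l)) ∘ₗ (MonoidAlgebra.coeffLinearEquiv ℂ).toLinearMap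

lemma cf_apply (l : List (Fin 3)) (x : A) : cf l x = x.coeff (FreeMonoid.ofList l) := rfl

lemma cf_e (l l' : List (Fin 3)) : cf l (e l') = if l' = l then 1 else 0 := by
  classical
  rw [cf_apply, e, MonoidAlgebra.coeff_single, Finsupp.single_apply]
  by_cases h : l' = l
  · simp [h]
  · rw [if_neg h, if_neg (fun h' => h (FreeMonoid.ofList.injective h'))]

/-- Linear extension of a function on words. -/
def ext {N : Type*} [AddCommGroup N] [Module ℂ N] (φ : List (Fin 3) → N) : A →ₗ[ℂ] N :=
  (Finsupp.linearCombination ℂ (fun w : FreeMonoid (Fin 3) => φ w.toList)) ∘ₗ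
    (MonoidAlgebra.coeffLinearEquiv ℂ).toLinearMap

lemma ext_e {N : Type*} [AddCommGroup N] [Module ℂ N] (φ : List (Fin 3) → N) (l : List (Fin 3)) :
    ext φ (e l) = φ l := by
  change Finsupp.linearCombination ℂ _ (e l).coeff = _
  rw [e, MonoidAlgebra.coeff_single, Finsupp.linearCombination_single]
  simp

lemma ext_apply {N : Type*} [AddCommGroup N] [Module ℂ N] (φ : List (Fin 3) → N) (x : A) :
    ext φ x = x.coeff.sum fun w c => c • φ w.toList := rfl

lemma A_hom_ext {N : Type*} [AddCommGroup N] [Module ℂ N] {f g : A →ₗ[ℂ] N}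
    (h : ∀ l, f (e l) = g (e l)) : f = g := by
  apply LinearMap.ext
  intro x
  induction x using MonoidAlgebra.induction_linear with
  | zero => simp
  | add x y hx hy => rw [map_add, map_add, hx, hy]
  | single a b =>
    have : (MonoidAlgebra.single a b : A) = b • e a.toList := by
      simp [e, MonoidAlgebra.smul_single]
    rw [this, map_smul, map_smul, h]

/-- The canonical map to the free associative algebra. -/
def iot : FL →ₗ⁅ℂ⁆ A := FreeLieAlgebra.lift ℂ (fun i => e [i])

lemma iot_of (i : Fin 3) : iot (FreeLieAlgebra.of ℂ i) = e [i] := by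
  simp [iot]

lemma iot_lie (u v : FL) : iot ⁅u, v⁆ = iot u * iot v - iot v * iot u := by
  rw [LieHom.map_lie, LieRing.of_associative_ring_bracket]

/-- Right normed brackets. -/
def bet : List (Fin 3) → FL
  | [] => 0
  | x :: l => if l = [] then FreeLieAlgebra.of ℂ x else ⁅FreeLieAlgebra.of ℂ x, bet l⁆

lemma bet_single (x : Fin 3) : bet [x] = FreeLieAlgebra.of ℂ x := by simp [bet]

lemma bet_cons (x : Fin 3) {l : List (Fin 3)} (h : l ≠ []) :
    bet (x :: l) = ⁅FreeLieAlgebra.of ℂ x, bet l⁆ := by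
  rw [bet, if_neg h]

/-- The Dynkin map. -/
def dyn : A →ₗ[ℂ] FL := ext bet

lemma dyn_mul (t : FreeMagma (Fin 3)) : ∀ (a : A) (i : Fin 3),
    dyn (iot (magmaToLie t) * (a * e [i])) = ⁅magmaToLie t, dyn (a * e [i])⁆ := by
  induction t with
  | ih1 j =>
    intro a i
    have : dyn ∘ₗ LinearMap.mulLeft ℂ (e [j]) ∘ₗ LinearMap.mulRight ℂ (e [i]) =
        (LieAlgebra.ad ℂ FL (FreeLieAlgebra.of ℂ j)) ∘ₗ dyn ∘ₗ LinearMap.mulRight ℂ (e [i]) := by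
      apply A_hom_ext
      intro l
      simp only [LinearMap.comp_apply, LinearMap.mulLeft_apply, LinearMap.mulRight_apply, e_mul, dyn,
        ext_e, LieAlgebra.ad_apply]
      exact bet_cons j (by simp)
    have h := LinearMap.congr_fun this a
    simpa [magmaToLie, iot_of] using h
  | ih2 u v hu hv =>
    intro a i
    have hu' := fun a => hu a i
    have hv' := fun a => hv a i
    change dyn (iot ⁅magmaToLie u, magmaToLie v⁆ * (a * e [i])) =
      ⁅⁅magmaToLie u, magmaToLie v⁆, dyn (a * e [i])⁆
    rw [iot_lie, sub_mul, map_sub, lie_lie, ← hv', ← hu']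
    rw [← mul_assoc (iot (magmaToLie v)) a, ← mul_assoc (iot (magmaToLie u)) a, ← hu', ← hv']
    simp only [mul_assoc]

lemma iot_right (t : FreeMagma (Fin 3)) :
    ∃ a : Fin 3 → A, iot (magmaToLie t) = ∑ i, a i * e [i] := by
  induction t with
  | ih1 j =>
    refine ⟨Pi.single j 1, ?_⟩
    rw [Finset.sum_eq_single j]
    · simp [magmaToLie, iot_of]
    · intro b _ hb; simp [hb]
    · simp
  | ih2 u v hu hv =>
    obtain ⟨a, ha⟩ := hu
    obtain ⟨b, hb⟩ := hv
    refine ⟨fun i => iot (magmaToLie u) * b i - iot (magmaToLie v) * a i, ?_⟩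
    change iot ⁅magmaToLie u, magmaToLie v⁆ = _
    rw [iot_lie]
    conv_lhs => rw [hb, Finset.mul_sum, ← hb, ha, Finset.mul_sum, ← ha]
    simp [sub_mul, mul_assoc]

lemma dyn_mul' (t s : FreeMagma (Fin 3)) :
    dyn (iot (magmaToLie t) * iot (magmaToLie s)) = ⁅magmaToLie t, dyn (iot (magmaToLie s))⁆ := by
  obtain ⟨a, ha⟩ := iot_right s
  rw [ha, Finset.mul_sum, map_sum, map_sum, lie_sum]
  exact Finset.sum_congr rfl fun i _ => dyn_mul t (a i) i

lemma dyn_iot (t : FreeMagma (Fin 3)) :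
    dyn (iot (magmaToLie t)) = (t.length : ℂ) • magmaToLie t := by
  induction t with
  | ih1 j => simp [magmaToLie, iot_of, dyn, ext_e, bet_single, FreeMagma.length]
  | ih2 u v hu hv =>
    change dyn (iot ⁅magmaToLie u, magmaToLie v⁆) =
      ((u.length + v.length : ℕ) : ℂ) • ⁅magmaToLie u, magmaToLie v⁆
    rw [iot_lie, map_sub, dyn_mul', dyn_mul', hu, hv, lie_smul, lie_smul,
      ← lie_skew (magmaToLie u) (magmaToLie v)]
    push_cast
    module

lemma dyn_iot_homog {n : ℕ} {u : FL} (hu : u ∈ homog n) : dyn (iot u) = (n : ℂ) • u := by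
  induction hu using Submodule.span_induction with
  | mem x hx =>
    obtain ⟨t, ht, rfl⟩ := hx
    rw [dyn_iot, show t.length = n from ht]
  | zero => simp
  | add x y _ _ hx hy => rw [map_add, map_add, hx, hy, smul_add]
  | smul c x _ hx => rw [map_smul, map_smul, hx, smul_comm]

/-- additive character on words -/
def chi (f : Fin 3 → ℂ) (l : List (Fin 3)) : ℂ := (l.map f).sum

/-- additive character on magma words -/
def chim (f : Fin 3 → ℂ) : FreeMagma (Fin 3) → ℂ
  | .of i => f i
  | .mul t u => chim f t + chim f u

/-- The diagonal derivation of `A`. -/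
def dg (f : Fin 3 → ℂ) : A →ₗ[ℂ] A := ext (fun l => chi f l • e l)

lemma dg_mul (f : Fin 3 → ℂ) (x y : A) : dg f (x * y) = dg f x * y + x * dg f y := by
  have : (LinearMap.mul ℂ A).compr₂ (dg f) =
      (LinearMap.mul ℂ A) ∘ₗ (dg f) + (LinearMap.mul ℂ A).compl₂ (dg f) := by
    apply A_hom_ext
    intro l
    apply A_hom_ext
    intro l'
    simp only [LinearMap.compr₂_apply, LinearMap.mul_apply', LinearMap.add_apply,
      LinearMap.comp_apply, LinearMap.compl₂_apply, e_mul, dg, ext_e, smul_mul_assoc, mul_smul_comm]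
    rw [← add_smul]
    simp [chi]
  exact LinearMap.congr_fun (LinearMap.congr_fun this x) y

lemma dg_iot (f : Fin 3 → ℂ) (t : FreeMagma (Fin 3)) :
    dg f (iot (magmaToLie t)) = chim f t • iot (magmaToLie t) := by
  induction t with
  | ih1 j => simp [magmaToLie, iot_of, dg, ext_e, chi, chim]
  | ih2 u v hu hv =>
    change dg f (iot ⁅magmaToLie u, magmaToLie v⁆) =
      (chim f u + chim f v) • iot ⁅magmaToLie u, magmaToLie v⁆
    rw [iot_lie, map_sub, dg_mul, dg_mul, hu, hv]
    simp only [smul_mul_assoc, mul_smul_comm]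
    module

lemma cf_dg (f : Fin 3 → ℂ) (l : List (Fin 3)) (x : A) : cf l (dg f x) = chi f l * cf l x := by
  have : cf l ∘ₗ dg f = chi f l • cf l := by
    apply A_hom_ext
    intro l'
    simp only [LinearMap.comp_apply, dg, ext_e, map_smul, LinearMap.smul_apply, cf_e, smul_eq_mul]
    split_ifs with h
    · rw [h]
    · simp
  exact LinearMap.congr_fun this x

lemma deriv_magma (H : LieDerivation ℂ FL FL) (f : Fin 3 → ℂ)
    (hH : ∀ i, H (FreeLieAlgebra.of ℂ i) = f i • FreeLieAlgebra.of ℂ i) (t : FreeMagma (Fin 3)) :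
    H (magmaToLie t) = chim f t • magmaToLie t := by
  induction t with
  | ih1 j => exact hH j
  | ih2 u v hu hv =>
    change H ⁅magmaToLie u, magmaToLie v⁆ = (chim f u + chim f v) • ⁅magmaToLie u, magmaToLie v⁆
    rw [LieDerivation.apply_lie_eq_add, hu, hv, lie_smul, smul_lie]
    module

lemma deriv_bet (H : LieDerivation ℂ FL FL) (f : Fin 3 → ℂ)
    (hH : ∀ i, H (FreeLieAlgebra.of ℂ i) = f i • FreeLieAlgebra.of ℂ i) (l : List (Fin 3)) :
    H (bet l) = chi f l • bet l := by
  induction l with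
  | nil => simp [bet]
  | cons x l ih =>
    by_cases h : l = []
    · subst h; simp [bet_single, hH, chi]
    · rw [bet_cons x h, LieDerivation.apply_lie_eq_add, ih, hH, lie_smul, smul_lie]
      simp only [chi, List.map_cons, List.sum_cons]
      module

lemma iot_deriv (H : LieDerivation ℂ FL FL) (f : Fin 3 → ℂ)
    (hH : ∀ i, H (FreeLieAlgebra.of ℂ i) = f i • FreeLieAlgebra.of ℂ i) {n : ℕ} {u : FL}
    (hu : u ∈ homog n) : iot (H u) = dg f (iot u) := by
  induction hu using Submodule.span_induction with
  | mem x hx =>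
    obtain ⟨t, ht, rfl⟩ := hx
    rw [dg_iot, deriv_magma H f hH, map_smul]
  | zero => simp
  | add x y _ _ hx hy => simp only [map_add, hx, hy]
  | smul c x _ hx => simp only [map_smul, hx]

lemma chim_one (t : FreeMagma (Fin 3)) : chim (fun _ => 1) t = t.length := by
  induction t with
  | ih1 j => simp [chim, FreeMagma.length]
  | ih2 u v hu hv =>
    change chim _ u + chim _ v = ((u.length + v.length : ℕ) : ℂ)
    rw [hu, hv]; push_cast; rfl

lemma iot_len {n : ℕ} {u : FL}
    (hu : u ∈ homog n) : dg (fun _ => 1) (iot u) = (n : ℂ) • iot u := by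
  induction hu using Submodule.span_induction with
  | mem x hx =>
    obtain ⟨t, ht, rfl⟩ := hx
    rw [dg_iot, chim_one, show t.length = n from ht]
  | zero => simp
  | add x y _ _ hx hy => simp only [map_add, hx, hy, smul_add]
  | smul c x _ hx => simp only [map_smul, hx]; rw [smul_comm]

lemma bet_mem (l : List (Fin 3)) (h : l ≠ []) : bet l ∈ homog l.length := by
  have : ∃ t : FreeMagma (Fin 3), t.length = l.length ∧ magmaToLie t = bet l := by
    induction l with
    | nil => exact absurd rfl h
    | cons x l ih =>
      by_cases h' : l = []
      · subst h'; exact ⟨.of x, rfl, by simp [magmaToLie, bet_single]⟩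
      · obtain ⟨t, ht, hb⟩ := ih h'
        refine ⟨.mul (.of x) t, ?_, ?_⟩
        · change 1 + t.length = _
          rw [ht, List.length_cons, add_comm]
        · rw [bet_cons x h', magmaToLie, hb, magmaToLie]
  obtain ⟨t, ht, hb⟩ := this
  exact Submodule.subset_span ⟨t, ht, hb⟩

/-- weights of letters for h₁ -/
def w1 : Fin 3 → ℤ := ![1, -1, 0]
/-- weights of letters for h₂ -/
def w2 : Fin 3 → ℤ := ![0, 1, -1]

/-- words of given weight. -/
abbrev W (n : ℕ) (a b : ℤ) : Type :=
  {f : Fin n → Fin 3 // ∑ i, w1 (f i) = a ∧ ∑ i, w2 (f i) = b}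

lemma chi_ofFn {n : ℕ} (f : Fin n → Fin 3) (w : Fin 3 → ℤ) :
    chi (fun i => (w i : ℂ)) (List.ofFn f) = ((∑ i, w (f i) : ℤ) : ℂ) := by
  simp [chi, List.map_ofFn, List.sum_ofFn]

section
variable (H1 H2 : LieDerivation ℂ FL FL)
    (h1 : ∀ i, H1 (FreeLieAlgebra.of ℂ i) = (w1 i : ℂ) • FreeLieAlgebra.of ℂ i)
    (h2 : ∀ i, H2 (FreeLieAlgebra.of ℂ i) = (w2 i : ℂ) • FreeLieAlgebra.of ℂ i)

/-- coefficient map -/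
def I (n : ℕ) (a b : ℤ) : wtsp2 H1 H2 n a b →ₗ[ℂ] (W n a b → ℂ) :=
  LinearMap.pi fun f => cf (List.ofFn f.1) ∘ₗ (iot : FL →ₗ[ℂ] A) ∘ₗ (wtsp2 H1 H2 n a b).subtype

lemma mem_wtsp2 {n : ℕ} {a b : ℤ} {u : FL} : u ∈ wtsp2 H1 H2 n a b ↔
    u ∈ homog n ∧ H1 u = (a : ℂ) • u ∧ H2 u = (b : ℂ) • u := by
  simp only [wtsp2, Submodule.mem_inf, Module.End.mem_eigenspace_iff, and_assoc]
  rfl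

include h1 h2

lemma bet_mem_wt {n : ℕ} (hn : n ≠ 0) {a b : ℤ} (f : W n a b) :
    bet (List.ofFn f.1) ∈ wtsp2 H1 H2 n a b := by
  rw [mem_wtsp2]
  refine ⟨?_, ?_, ?_⟩
  · have := bet_mem (List.ofFn f.1) (by simpa [List.ofFn_eq_nil_iff] using hn)
    simpa using this
  · rw [deriv_bet H1 _ h1, chi_ofFn f.1 w1, f.2.1]
  · rw [deriv_bet H2 _ h2, chi_ofFn f.1 w2, f.2.2]

lemma dim_formula {n : ℕ} (hn : n ≠ 0) (a b : ℤ) :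
    FiniteDimensional ℂ (wtsp2 H1 H2 n a b) ∧
    (n : ℂ) * (Module.finrank ℂ (wtsp2 H1 H2 n a b) : ℂ) =
      ∑ f : W n a b, cf (List.ofFn f.1) (iot (bet (List.ofFn f.1))) := by
  classical
  let P : (W n a b → ℂ) →ₗ[ℂ] wtsp2 H1 H2 n a b :=
    Fintype.linearCombination ℂ (fun f : W n a b =>
      (⟨bet (List.ofFn f.1), bet_mem_wt H1 H2 h1 h2 hn f⟩ : wtsp2 H1 H2 n a b))
  have hPI : P ∘ₗ I H1 H2 n a b = (n : ℂ) • LinearMap.id := by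
    ext ⟨u, hu⟩
    have hu' := (mem_wtsp2 H1 H2).1 hu
    have e1 : ((P ∘ₗ I H1 H2 n a b) ⟨u, hu⟩ : FL) =
        ∑ f : W n a b, cf (List.ofFn f.1) (iot u) • bet (List.ofFn f.1) := by
      simp only [LinearMap.comp_apply, P, Fintype.linearCombination_apply, I]
      rw [Submodule.coe_sum]
      rfl
    rw [e1]
    change _ = (n : ℂ) • u
    rw [← dyn_iot_homog hu'.1, dyn, ext_apply]
    have hsupp : (iot u).coeff.support ⊆
        Finset.univ.image (fun f : W n a b => FreeMonoid.ofList (List.ofFn f.1)) := by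
      intro w hw
      rw [Finsupp.mem_support_iff] at hw
      have hc : cf w.toList (iot u) ≠ 0 := by simpa [cf_apply] using hw
      have a0 := cf_dg (fun _ => 1) w.toList (iot u)
      rw [iot_len hu'.1, map_smul, smul_eq_mul] at a0
      have a1 := cf_dg (fun i => (w1 i : ℂ)) w.toList (iot u)
      rw [← iot_deriv H1 _ h1 hu'.1, hu'.2.1, map_smul, map_smul, smul_eq_mul] at a1
      have a2 := cf_dg (fun i => (w2 i : ℂ)) w.toList (iot u)
      rw [← iot_deriv H2 _ h2 hu'.1, hu'.2.2, map_smul, map_smul, smul_eq_mul] at a2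
      have b0 := mul_right_cancel₀ hc a0
      have b1 := mul_right_cancel₀ hc a1
      have b2 := mul_right_cancel₀ hc a2
      have hlen : w.toList.length = n := by
        have : (n : ℂ) = (w.toList.length : ℂ) := by rw [b0]; simp [chi]
        exact_mod_cast this.symm
      subst hlen
      rw [Finset.mem_image]
      refine ⟨⟨w.toList.get, ?_, ?_⟩, Finset.mem_univ _, ?_⟩
      · have := chi_ofFn w.toList.get w1
        rw [List.ofFn_get, ← b1] at this
        exact_mod_cast this.symm
      · have := chi_ofFn w.toList.get w2
        rw [List.ofFn_get, ← b2] at this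
        exact_mod_cast this.symm
      · simp only [List.ofFn_get, FreeMonoid.ofList_toList]
    rw [Finsupp.sum_of_support_subset _ hsupp _ (by simp), Finset.sum_image]
    · rfl
    · intro f _ g _ hfg
      exact Subtype.ext (List.ofFn_injective (FreeMonoid.ofList.injective hfg))
  have hsurj : Function.Surjective P := by
    intro u
    refine ⟨(n : ℂ)⁻¹ • I H1 H2 n a b u, ?_⟩
    have := LinearMap.congr_fun hPI u
    rw [LinearMap.comp_apply] at this
    rw [map_smul, this, LinearMap.smul_apply, LinearMap.id_apply, smul_smul, inv_mul_cancel₀,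
      one_smul]
    exact_mod_cast hn
  have hfd : FiniteDimensional ℂ (wtsp2 H1 H2 n a b) := Module.Finite.of_surjective P hsurj
  refine ⟨hfd, ?_⟩
  have ht := LinearMap.trace_comp_comm' (I H1 H2 n a b) P
  rw [hPI, map_smul, LinearMap.trace_id, smul_eq_mul] at ht
  rw [ht, LinearMap.trace_eq_matrix_trace ℂ (Pi.basisFun ℂ (W n a b)), Matrix.trace]
  apply Finset.sum_congr rfl
  intro f _
  rw [Matrix.diag_apply, LinearMap.toMatrix_apply, Pi.basisFun_apply, Pi.basisFun_repr]
  simp only [LinearMap.comp_apply, P, Fintype.linearCombination_apply_single, one_smul]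
  rfl

end

/-- Expansion of the right normed bracket of a word. -/
def expd {α : Type} : List α → List (ℤ × List α)
  | [] => []
  | x :: l => if l.isEmpty then [(1, [x])] else
      (expd l).map (fun p => (p.1, x :: p.2)) ++ (expd l).map (fun p => (-p.1, p.2 ++ [x]))

lemma expd_map {α γ : Type} (g : α → γ) (l : List α) :
    expd (l.map g) = (expd l).map (fun p => (p.1, p.2.map g)) := by
  induction l with
  | nil => rfl
  | cons x l ih =>
    simp only [List.map_cons, expd, ih, List.isEmpty_map]
    split_ifs
    · simp
    · simp [Function.comp_def]

lemma iot_bet (l : List (Fin 3)) :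
    iot (bet l) = ((expd l).map (fun p => (p.1 : ℂ) • e p.2)).sum := by
  induction l with
  | nil => simp [bet, expd]
  | cons x l ih =>
    by_cases h : l = []
    · subst h; simp [bet_single, expd, iot_of]
    · rw [bet_cons x h, iot_lie, ih, iot_of, expd, if_neg (by simpa using h)]
      rw [List.map_append, List.sum_append, ← List.sum_map_mul_left, ← List.sum_map_mul_right,
        sub_eq_add_neg]
      congr 1
      · simp [List.map_map, Function.comp_def, e_mul]
      · rw [← neg_one_mul, ← List.sum_map_mul_left]
        simp [List.map_map, Function.comp_def, e_mul]

lemma cf_bet (l l' : List (Fin 3)) : cf l' (iot (bet l)) =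
    (((expd l).map (fun p => p.1 * if p.2 = l' then 1 else 0)).sum : ℤ) := by
  rw [iot_bet, map_list_sum, List.map_map, Int.cast_list_sum, List.map_map]
  congr 1
  apply List.map_congr_left
  intro p _
  simp [cf_e]

end SL

namespace SL

/-- Evaluate `n` before passing it on. -/
def force {α : Type} (n : ℕ) (k : ℕ → α) : α :=
  match n with
  | 0 => k 0
  | m + 1 => k (m + 1)

lemma force_eq {α : Type} (n : ℕ) (k : ℕ → α) : force n k = k n := by
  cases n <;> rfl

/-- Hexadecimal digit. -/
def dig (l i : ℕ) : ℕ := Nat.land (Nat.shiftRight l (Nat.mul 4 i)) 15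

/-- Cycle length, if `i` is the smallest element of its cycle; otherwise zero. -/
def clen (l i : ℕ) : ℕ → ℕ → ℕ → ℕ
  | 0, _, _ => 0
  | k + 1, cur, len => bif Nat.beq cur i then len else
      bif Nat.blt cur i then 0 else force (dig l cur) fun c => clen l i k c (Nat.add len 1)

/-- Ordered insertion. -/
def ins (a : ℕ) : List ℕ → List ℕ
  | [] => [a]
  | b :: t => bif Nat.blt a b then a :: b :: t else b :: ins a t

/-- Sorted list of cycle leaders with lengths. -/
def lead (l : ℕ) : ℕ → List ℕ
  | 0 => []
  | i + 1 => force (clen l i 20 (dig l i) 1) fun c =>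
      bif Nat.beq c 0 then lead l i else force (Nat.add (Nat.mul 16 c) i) fun a => ins a (lead l i)

/-- Emit one cycle. -/
def emit {α : Type} (l start : ℕ) : ℕ → ℕ → ℕ → ℕ → ℕ → ℕ → (ℕ → ℕ → ℕ → ℕ → α) → α
  | 0, _, pos, g, g', c, K => K pos g g' c
  | k + 1, cur, pos, g, g', c, K =>
    force (dig l cur) fun cur' =>
    force (Nat.add pos 1) fun pos' =>
    force (Nat.add g (Nat.shiftLeft cur (Nat.mul 4 pos))) fun g1 =>
    force (Nat.add g' (Nat.shiftLeft pos (Nat.mul 4 cur))) fun g2 =>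
    force (Nat.add c (Nat.shiftLeft (bif Nat.beq k 0 then start else pos') (Nat.mul 4 pos))) fun c1 =>
      emit l start k cur' pos' g1 g2 c1 K

/-- Emit all cycles. -/
def emits {α : Type} (l : ℕ) (K : ℕ → ℕ → ℕ → α) : List ℕ → ℕ → ℕ → ℕ → ℕ → α
  | [], _, g, g', c => K g g' c
  | a :: t, pos, g, g', c =>
    force (Nat.land a 15) fun i =>
    emit l pos (Nat.shiftRight a 4) i pos g g' c fun pos g g' c => emits l K t pos g g' c

/-- Check a conjugation certificate. -/
def chk (n l g g' c : ℕ) : ℕ → Bool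
  | 0 => true
  | i + 1 => force (dig g i) fun a => force (dig g' i) fun b => force (dig c i) fun d =>
      bif Nat.blt a n then bif Nat.blt b n then bif Nat.blt d n then
      bif Nat.beq (dig g b) i then bif Nat.beq (dig l a) (dig g d) then chk n l g g' c i
      else false else false else false else false else false

/-- Canonical conjugate. -/
def canon (n l : ℕ) : ℕ :=
  emits l (fun g g' c => bif chk n l g g' c n then c else l) (lead l n) 0 0 0 0

/-- Merge association lists. -/
def mergeA : ℕ → List (ℕ × ℤ) → List (ℕ × ℤ) → List (ℕ × ℤ)
  | 0, A, B => A ++ B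
  | _ + 1, [], B => B
  | _ + 1, a :: A, [] => a :: A
  | k + 1, a :: A, b :: B =>
    bif Nat.beq a.1 b.1 then
      (if a.2 + b.2 = 0 then mergeA k A B else (a.1, a.2 + b.2) :: mergeA k A B)
    else bif Nat.blt a.1 b.1 then a :: mergeA k A (b :: B) else b :: mergeA k (a :: A) B

/-- Sum over the tree of signed words. -/
def treeP (n : ℕ) : ℕ → ℕ → ℕ → ℤ → List (ℕ × ℤ)
  | 0, _, cur, s => force (canon n cur) fun c => [(c, s)]
  | k + 1, len, cur, s =>
    mergeA 1000
      (force (Nat.add k (Nat.mul 16 cur)) fun cur' => treeP n k (Nat.add len 1) cur' s)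
      (force (Nat.add cur (Nat.mul k (Nat.pow 16 len))) fun cur' => treeP n k (Nat.add len 1) cur' (-s))

/-- Evaluate an association list. -/
def evalA (F : ℕ → ℤ) (A : List (ℕ × ℤ)) : ℤ := (A.map fun p => p.2 * F p.1).sum

lemma evalA_cons (F : ℕ → ℤ) (a : ℕ × ℤ) (A : List (ℕ × ℤ)) :
    evalA F (a :: A) = a.2 * F a.1 + evalA F A := by simp [evalA]

lemma evalA_merge (F : ℕ → ℤ) (k : ℕ) : ∀ A B : List (ℕ × ℤ),
    evalA F (mergeA k A B) = evalA F A + evalA F B := by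
  induction k with
  | zero => intro A B; simp [mergeA, evalA]
  | succ k ih =>
    intro A B
    cases A with
    | nil => simp [mergeA, evalA]
    | cons a A =>
      cases B with
      | nil => simp [mergeA, evalA]
      | cons b B =>
        rw [mergeA]
        cases h : Nat.beq a.1 b.1 with
        | true =>
          have h' : a.1 = b.1 := Nat.eq_of_beq_eq_true h
          simp only [cond_true]
          split_ifs with h0
          · rw [ih, evalA_cons, evalA_cons, ← h']
            have : a.2 = - b.2 := by omega
            rw [this]; ring
          · rw [evalA_cons, ih, evalA_cons, evalA_cons, ← h']; ring
        | false =>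
          simp only [cond_false]
          cases h2 : Nat.blt a.1 b.1 with
          | true => simp only [cond_true]; rw [evalA_cons, ih, evalA_cons, evalA_cons]; ring
          | false => simp only [cond_false]; rw [evalA_cons, ih, evalA_cons, evalA_cons]; ring

lemma emit_ind {α : Type} (P : α → Prop) (l start : ℕ) (K : ℕ → ℕ → ℕ → ℕ → α)
    (hK : ∀ a b c d, P (K a b c d)) (k : ℕ) : ∀ cur pos g g' c,
    P (emit l start k cur pos g g' c K) := by
  induction k with
  | zero => intro cur pos g g' c; exact hK _ _ _ _
  | succ k ih =>
    intro cur pos g g' c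
    simp only [emit, force_eq]
    exact ih _ _ _ _ _

lemma emits_ind {α : Type} (P : α → Prop) (l : ℕ) (K : ℕ → ℕ → ℕ → α)
    (hK : ∀ a b c, P (K a b c)) (t : List ℕ) : ∀ pos g g' c,
    P (emits l K t pos g g' c) := by
  induction t with
  | nil => intro pos g g' c; exact hK _ _ _
  | cons a t ih =>
    intro pos g g' c
    simp only [emits, force_eq]
    exact emit_ind P _ _ _ (fun _ _ _ _ => ih _ _ _ _) _ _ _ _ _ _

lemma chk_spec (n l g g' c : ℕ) (k : ℕ) (h : chk n l g g' c k = true) : ∀ i < k,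
    dig g i < n ∧ dig g' i < n ∧ dig c i < n ∧ dig g (dig g' i) = i ∧
      dig l (dig g i) = dig g (dig c i) := by
  induction k with
  | zero => intro i hi; omega
  | succ k ih =>
    simp only [chk, force_eq, Bool.cond_false_right, Bool.and_eq_true, Nat.blt_eq,
      Nat.beq_eq] at h
    obtain ⟨h1, h2, h3, h4, h5, h6⟩ := h
    intro i hi
    rcases Nat.lt_succ_iff_lt_or_eq.1 hi with h | rfl
    · exact ih h6 i h
    · exact ⟨h1, h2, h3, h4, h5⟩

/-- Extension of a word to all of `ℕ`. -/
def xt {n : ℕ} (f : Fin n → Fin 3) (j : ℕ) : Fin 3 := if h : j < n then f ⟨j, h⟩ else 0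

lemma xt_lt {n : ℕ} (f : Fin n → Fin 3) {j : ℕ} (h : j < n) : xt f j = f ⟨j, h⟩ := dif_pos h

/-- Words of weight `(a, b)` fixed by the packed permutation `l`. -/
abbrev Fx (n : ℕ) (a b : ℤ) (l : ℕ) : Type :=
  {f : W n a b // ∀ i < n, xt f.1 (dig l i) = xt f.1 i}

/-- Number of fixed words. -/
def cnt (n : ℕ) (a b : ℤ) (l : ℕ) : ℤ := Nat.card (Fx n a b l)

lemma chk_cnt (n : ℕ) (a b : ℤ) (l g g' c : ℕ) (h : chk n l g g' c n = true) :
    cnt n a b c = cnt n a b l := by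
  have H := chk_spec n l g g' c n h
  let G : Fin n → Fin n := fun i => ⟨dig g i, (H i i.2).1⟩
  have hs : Function.Surjective G := by
    intro i
    refine ⟨⟨dig g' i, (H i i.2).2.1⟩, ?_⟩
    exact Fin.ext (H i i.2).2.2.2.1
  have hb : Function.Bijective G := Finite.surjective_iff_bijective.1 hs
  let E : Equiv.Perm (Fin n) := Equiv.ofBijective G hb
  unfold cnt
  congr 1
  symm
  have hx : ∀ (f : Fin n → Fin 3) (i : ℕ), i < n → xt (f ∘ E) i = xt f (dig g i) := by
    intro f i hi
    rw [xt_lt _ hi, xt_lt _ (H i hi).1]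
    rfl
  let E1 : W n a b ≃ W n a b := (Equiv.arrowCongr E.symm (Equiv.refl _)).subtypeEquiv (by
    intro f
    have : (Equiv.arrowCongr E.symm (Equiv.refl (Fin 3))) f = f ∘ E := by ext; simp
    rw [this]
    have e1 := Equiv.sum_comp E (fun i => w1 (f i))
    have e2 := Equiv.sum_comp E (fun i => w2 (f i))
    simp only [Function.comp_apply]
    rw [e1, e2])
  refine Nat.card_congr (E1.subtypeEquiv ?_)
  intro f
  have h1 : (E1 f).1 = f.1 ∘ E := by ext; simp [E1]
  rw [h1]
  constructor
  · intro hf i hi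
    rw [hx _ _ hi, hx _ _ (H i hi).2.2.1, ← (H i hi).2.2.2.2, hf _ (H i hi).1]
  · intro hf i hi
    have hj := (H i hi).2.1
    have := hf _ hj
    rw [hx _ _ hj, hx _ _ (H _ hj).2.2.1, ← (H _ hj).2.2.2.2, (H i hi).2.2.2.1] at this
    exact this

lemma cnt_canon (n : ℕ) (a b : ℤ) (l : ℕ) : cnt n a b (canon n l) = cnt n a b l := by
  apply emits_ind (fun r => cnt n a b r = cnt n a b l)
  intro g g' c
  cases h : chk n l g g' c n with
  | true => exact chk_cnt n a b l g g' c h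
  | false => rfl

/-- Pack a list. -/
def pack : List ℕ → ℕ
  | [] => 0
  | x :: l => x + 16 * pack l

lemma pack_append (l : List ℕ) (x : ℕ) : pack (l ++ [x]) = pack l + x * 16 ^ l.length := by
  induction l with
  | nil => simp [pack]
  | cons y l ih => simp only [List.cons_append, pack, ih, List.length_cons, pow_succ]; ring

lemma dig_eq (l i : ℕ) : dig l i = l / 16 ^ i % 16 := by
  change (l >>> (4 * i)) &&& 15 = _
  rw [Nat.and_two_pow_sub_one_eq_mod _ 4, Nat.shiftRight_eq_div_pow, pow_mul]
  norm_num

lemma dig_pack (l : List ℕ) (hl : ∀ x ∈ l, x < 16) (i : ℕ) (hi : i < l.length) :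
    dig (pack l) i = l[i] := by
  induction l generalizing i with
  | nil => simp at hi
  | cons x l ih =>
    have hx : x < 16 := hl x (by simp)
    cases i with
    | zero => rw [dig_eq, pack]; simp; omega
    | succ i =>
      have := ih (fun y hy => hl y (by simp [hy])) i (by simpa using hi)
      rw [dig_eq] at this ⊢
      rw [pack, pow_succ', ← Nat.div_div_eq_div_mul, show (x + 16 * pack l) / 16 = pack l by omega,
        this]
      simp

/-- Sum over the tree, lists version. -/
def treeG (G : List ℕ → ℤ) : ℕ → List ℕ → ℤ
  | 0, l => G l
  | k + 1, l => treeG G k (k :: l) - treeG G k (l ++ [k])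

lemma expd_cons {α : Type} (x : α) {l : List α} (h : l ≠ []) (G : List α → ℤ) :
    ((expd (x :: l)).map fun p => p.1 * G p.2).sum =
      ((expd l).map fun p => p.1 * (G (x :: p.2) - G (p.2 ++ [x]))).sum := by
  rw [expd, if_neg (by simpa using h), List.map_append, List.sum_append, List.map_map, List.map_map]
  rw [← List.sum_map_add]
  congr 1
  apply List.map_congr_left
  intro p _
  simp only [Function.comp_apply]
  ring

lemma tree_expd (G : List ℕ → ℤ) (k : ℕ) : ∀ l : List ℕ, l ≠ [] →
    ((expd (List.range k ++ l)).map fun p => p.1 * G p.2).sum =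
      ((expd l).map fun p => p.1 * treeG G k p.2).sum := by
  induction k with
  | zero => intro l _; simp [treeG]
  | succ k ih =>
    intro l hl
    rw [List.range_succ, List.append_assoc, List.singleton_append, ih _ (by simp),
      expd_cons k hl]
    rfl

lemma treeP_eq (n : ℕ) (a b : ℤ) (k : ℕ) : ∀ (l : List ℕ) (s : ℤ),
    evalA (cnt n a b) (treeP n k l.length (pack l) s) =
      s * treeG (fun l => cnt n a b (pack l)) k l := by
  induction k with
  | zero =>
    intro l s
    simp only [treeP, force_eq, treeG]
    rw [evalA_cons, cnt_canon]
    simp [evalA]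
  | succ k ih =>
    intro l s
    have h1 := ih (k :: l) s
    have h2 := ih (l ++ [k]) (-s)
    rw [pack_append, List.length_append] at h2
    simp only [treeP, force_eq, treeG]
    rw [evalA_merge]
    refine (congrArg₂ (· + ·) h1 h2).trans ?_
    ring

lemma expd_perm {α : Type} (l : List α) : ∀ p ∈ expd l, p.2.Perm l := by
  induction l with
  | nil => simp [expd]
  | cons x l ih =>
    intro p hp
    rw [expd] at hp
    split_ifs at hp with h
    · simp only [List.mem_singleton] at hp
      subst hp
      have : l = [] := by simpa using h
      subst this
      exact List.Perm.refl _
    · rw [List.mem_append, List.mem_map, List.mem_map] at hp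
      rcases hp with ⟨q, hq, rfl⟩ | ⟨q, hq, rfl⟩
      · exact (ih q hq).cons x
      · exact (List.perm_append_singleton x q.2).trans ((ih q hq).cons x)

lemma ofFn_xt {n : ℕ} (f : Fin n → Fin 3) : List.ofFn f = (List.range n).map (xt f) := by
  apply List.ext_getElem
  · simp
  · intro i h1 h2
    have : i < n := by simpa using h1
    simp [xt_lt f this]

lemma list_fix {n : ℕ} (hn : n ≤ 16) (f : Fin n → Fin 3) (l : List ℕ) (hl : l.Perm (List.range n)) :
    l.map (xt f) = List.ofFn f ↔ ∀ i < n, xt f (dig (pack l) i) = xt f i := by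
  have hlen : l.length = n := by simpa using hl.length_eq
  have hlt : ∀ x ∈ l, x < 16 := by
    intro x hx
    have : x < n := by simpa using (hl.mem_iff (a := x)).1 hx
    omega
  rw [ofFn_xt]
  constructor
  · intro h i hi
    rw [dig_pack l hlt i (by omega)]
    have := List.getElem_of_eq h (i := i) (by simp; omega)
    simpa using this
  · intro h
    apply List.ext_getElem
    · simp [hlen]
    · intro i h1 h2
      have hi : i < n := by simpa using h2
      have := h i hi
      rw [dig_pack l hlt i (by omega)] at this
      simpa using this

lemma sum_list {ι β : Type} [Fintype ι] (L : List (ℤ × β)) (g : ι → ℤ × β → ℤ) :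
    ∑ x, (L.map (fun p => p.1 * g x p)).sum = (L.map fun p => p.1 * ∑ x, g x p).sum := by
  induction L with
  | nil => simp
  | cons p L ih =>
    simp only [List.map_cons, List.sum_cons]
    rw [Finset.sum_add_distrib, ih, Finset.mul_sum]

lemma sum_cf (n : ℕ) (hn : n < 16) (a b : ℤ) :
    ∑ f : W (n + 1) a b, cf (List.ofFn f.1) (iot (bet (List.ofFn f.1))) =
      ((evalA (cnt (n + 1) a b) (treeP (n + 1) n 1 n 1) : ℤ) : ℂ) := by
  have h1 : ∀ f : W (n + 1) a b, cf (List.ofFn f.1) (iot (bet (List.ofFn f.1))) =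
      (((expd (List.range (n + 1))).map
        (fun p => p.1 * if ∀ i < n + 1, xt f.1 (dig (pack p.2) i) = xt f.1 i then 1 else 0)).sum : ℤ) := by
    intro f
    rw [cf_bet]
    congr 2
    conv_lhs => rw [ofFn_xt, expd_map, List.map_map]
    apply List.map_congr_left
    intro p hp
    simp only [Function.comp_apply]
    congr 1
    rw [← ofFn_xt]
    exact if_congr (list_fix (by omega) f.1 p.2 (expd_perm _ p hp)) rfl rfl
  rw [Finset.sum_congr rfl fun f _ => h1 f, ← Int.cast_sum]
  congr 1
  have h2 := treeP_eq (n + 1) a b n [n] 1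
  simp only [pack, List.length_singleton, mul_zero, add_zero, one_mul] at h2
  rw [h2]
  have h3 := tree_expd (fun l => cnt (n + 1) a b (pack l)) n [n] (by simp)
  simp only [expd, List.isEmpty_nil, if_true, List.map_singleton, List.sum_singleton, one_mul] at h3
  rw [← h3, ← List.range_succ]
  rw [sum_list]
  congr 1
  apply List.map_congr_left
  intro p _
  congr 1
  rw [Finset.sum_boole, cnt, Nat.card_eq_fintype_card, Fintype.card_subtype]

/-- Codes of letters. -/
def lcode : Fin 3 → ℕ := ![34, 64, 1]

lemma lcode_eq (x : Fin 3) : (lcode x : ℤ) = (w1 x + 1) + 32 * (w2 x + 1) := by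
  fin_cases x <;> rfl

/-- Shift the keys of an association list. -/
def shA (s : ℕ) (A : List (ℕ × ℤ)) : List (ℕ × ℤ) := A.map fun p => (Nat.add s p.1, p.2)

/-- Distribution of codes. -/
def distr (d : ℕ) : ℕ → List (ℕ × ℤ)
  | 0 => [(0, 1)]
  | k + 1 => mergeA 1000 (shA (Nat.mul d 34) (distr d k))
      (mergeA 1000 (shA (Nat.mul d 64) (distr d k)) (shA (Nat.mul d 1) (distr d k)))

lemma evalA_shA (F : ℕ → ℤ) (s : ℕ) (A : List (ℕ × ℤ)) :
    evalA F (shA s A) = evalA (fun k => F (s + k)) A := by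
  simp only [evalA, shA, List.map_map]
  rfl

lemma distr_eq (d k : ℕ) : ∀ G : ℕ → ℤ,
    ∑ g : Fin k → Fin 3, G (d * ∑ i, lcode (g i)) = evalA G (distr d k) := by
  induction k with
  | zero => intro G; simp [distr, evalA]
  | succ k ih =>
    intro G
    rw [← (Fin.consEquiv (fun _ => Fin 3)).sum_comp, Fintype.sum_prod_type, distr, evalA_merge,
      evalA_merge, evalA_shA, evalA_shA, evalA_shA, ← ih, ← ih, ← ih, Fin.sum_univ_three, add_assoc]
    simp only [Fin.consEquiv_apply, Fin.sum_univ_succ, Fin.cons_zero, Fin.cons_succ, mul_add]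
    rfl

lemma w_bound (x : Fin 3) : -1 ≤ w1 x ∧ w1 x ≤ 1 ∧ -1 ≤ w2 x ∧ w2 x ≤ 1 := by
  fin_cases x <;> simp [w1, w2]

lemma code_iff {n : ℕ} (hn : n < 16) (f : Fin n → Fin 3) (a b : ℤ) (t : ℕ)
    (ha : 0 ≤ a + n) (ha' : a + n < 32) (ht : (t : ℤ) = a + n + 32 * (b + n)) :
    (∑ i, w1 (f i) = a ∧ ∑ i, w2 (f i) = b) ↔ ∑ i, lcode (f i) = t := by
  have h : ((∑ i, lcode (f i) : ℕ) : ℤ) = (∑ i, w1 (f i) + n) + 32 * (∑ i, w2 (f i) + n) := by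
    push_cast
    simp only [lcode_eq, Finset.sum_add_distrib, ← Finset.mul_sum]
    simp
  have l1 : -(n : ℤ) ≤ ∑ i, w1 (f i) := by
    have := Finset.card_nsmul_le_sum Finset.univ (fun i => w1 (f i)) (-1) (fun i _ => (w_bound _).1)
    simpa using this
  have l2 : ∑ i, w1 (f i) ≤ n := by
    have := Finset.sum_le_card_nsmul Finset.univ (fun i => w1 (f i)) 1 (fun i _ => (w_bound _).2.1)
    simpa using this
  constructor
  · rintro ⟨h1, h2⟩
    rw [h1, h2] at h
    omega
  · intro h3
    rw [h3] at h
    omega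

lemma cnt_block (n m d c : ℕ) (hnm : n = m * d) (hd : 0 < d) (hn : n < 16) (a b : ℤ) (t : ℕ)
    (ha : 0 ≤ a + n) (ha' : a + n < 32) (ht : (t : ℤ) = a + n + 32 * (b + n))
    (h1 : ∀ i < n, dig c i < n ∧ dig c i / d = i / d)
    (h2 : ∀ i < n, i % d ≠ 0 → dig c (i - 1) = i) :
    cnt n a b c = evalA (fun k => if k = t then 1 else 0) (distr d m) := by
  subst hnm
  rw [← distr_eq, Finset.sum_boole, cnt]
  congr 1
  rw [← Fintype.card_subtype, ← Nat.card_eq_fintype_card]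
  have hdiv : ∀ i : Fin (m * d), (i : ℕ) / d < m := fun i =>
    Nat.div_lt_of_lt_mul (lt_of_lt_of_eq i.2 (mul_comm m d))
  have hmul : ∀ j : Fin m, (j : ℕ) * d < m * d := fun j => Nat.mul_lt_mul_of_pos_right j.2 hd
  have hk : ∀ g : Fin m → Fin 3, ∑ i : Fin (m * d), lcode (g ⟨i / d, hdiv i⟩) = d * ∑ j, lcode (g j) := by
    intro g
    rw [← finProdFinEquiv.sum_comp, Fintype.sum_prod_type, Finset.mul_sum]
    apply Finset.sum_congr rfl
    intro x _
    have : ∀ y : Fin d, (⟨(finProdFinEquiv (x, y) : Fin (m * d)) / d, hdiv _⟩ : Fin m) = x := by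
      intro y
      apply Fin.ext
      simp only [finProdFinEquiv_apply_val]
      rw [Nat.add_mul_div_left _ _ hd, Nat.div_eq_of_lt y.2, zero_add]
    rw [Finset.sum_congr rfl fun y _ => congrArg (fun z => lcode (g z)) (this y)]
    simp
  have hstep : ∀ f : Fx (m * d) a b c, ∀ i : ℕ, i < m * d → xt f.1.1 i = xt f.1.1 (i / d * d) := by
    intro f i
    induction i with
    | zero => simp
    | succ i ih =>
      intro hi
      by_cases hm : (i + 1) % d = 0
      · rw [Nat.div_mul_cancel (Nat.dvd_of_mod_eq_zero hm)]
      · have e := h2 (i + 1) hi hm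
        rw [Nat.add_sub_cancel] at e
        have e2 := f.2 i (by omega)
        rw [e] at e2
        have e3 := (h1 i (by omega)).2
        rw [e] at e3
        rw [e2, ih (by omega), e3]
  refine Nat.card_congr
    { toFun := fun f => ⟨fun j => f.1.1 ⟨j * d, hmul j⟩, ?_⟩
      invFun := fun g => ⟨⟨fun i => g.1 ⟨i / d, hdiv i⟩, ?_⟩, ?_⟩
      left_inv := ?_
      right_inv := ?_ }
  · have := (code_iff hn f.1.1 a b t ha ha' ht).1 f.1.2
    rw [← hk, ← this]
    apply Finset.sum_congr rfl
    intro i _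
    have e := hstep f i i.2
    rw [xt_lt _ i.2, xt_lt _ (hmul ⟨i / d, hdiv i⟩)] at e
    rw [← e]
  · rw [code_iff hn _ a b t ha ha' ht, hk, g.2]
  · intro i hi
    rw [xt_lt _ hi, xt_lt _ (h1 i hi).1]
    exact congrArg g.1 (Fin.ext (h1 i hi).2)
  · intro f
    apply Subtype.ext
    apply Subtype.ext
    funext i
    have e := hstep f i i.2
    rw [xt_lt _ i.2, xt_lt _ (hmul ⟨i / d, hdiv i⟩)] at e
    exact e.symm
  · intro g
    apply Subtype.ext
    funext j
    exact congrArg g.1 (Fin.ext (Nat.mul_div_cancel _ hd))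

theorem tree3 : treeP 3 2 1 2 1 = [(33, -1), (528, 1)] := by decide +kernel

theorem tree6 : treeP 6 5 1 5 1 =
    [(344865, 1), (3489825, -1), (4530945, -1), (5517840, 1)] := by decide +kernel

theorem tree12 : treeP 12 11 1 11 1 =
    [(118375858914081, 1), (171139535290401, -1), (188606631453441, -1), (205163983024656, 1)] := by
  decide +kernel

/-- Number of block words with code `t`. -/
def bl (d m t : ℕ) : ℤ := evalA (fun k => if k = t then 1 else 0) (distr d m)

lemma cval3 (a b : ℤ) (t : ℕ) (ha : 0 ≤ a + 3) (ha' : a + 3 < 32)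
    (ht : (t : ℤ) = a + 3 + 32 * (b + 3)) :
    evalA (cnt 3 a b) (treeP 3 2 1 2 1) = bl 1 3 t - bl 3 1 t := by
  rw [tree3, evalA_cons, evalA_cons]
  dsimp only
  rw [cnt_block 3 1 3 33 rfl (by norm_num) (by norm_num) a b t ha ha' ht (by decide) (by decide),
    cnt_block 3 3 1 528 rfl (by norm_num) (by norm_num) a b t ha ha' ht (by decide) (by decide)]
  simp only [evalA, bl, List.map_nil, List.sum_nil]
  ring

lemma cval6 (a b : ℤ) (t : ℕ) (ha : 0 ≤ a + 6) (ha' : a + 6 < 32)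
    (ht : (t : ℤ) = a + 6 + 32 * (b + 6)) :
    evalA (cnt 6 a b) (treeP 6 5 1 5 1) = bl 1 6 t - bl 2 3 t - bl 3 2 t + bl 6 1 t := by
  rw [tree6, evalA_cons, evalA_cons, evalA_cons, evalA_cons]
  dsimp only
  rw [cnt_block 6 1 6 344865 rfl (by norm_num) (by norm_num) a b t ha ha' ht (by decide) (by decide),
    cnt_block 6 2 3 3489825 rfl (by norm_num) (by norm_num) a b t ha ha' ht (by decide) (by decide),
    cnt_block 6 3 2 4530945 rfl (by norm_num) (by norm_num) a b t ha ha' ht (by decide) (by decide),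
    cnt_block 6 6 1 5517840 rfl (by norm_num) (by norm_num) a b t ha ha' ht (by decide) (by decide)]
  simp only [evalA, bl, List.map_nil, List.sum_nil]
  ring

lemma cval12 (a b : ℤ) (t : ℕ) (ha : 0 ≤ a + 12) (ha' : a + 12 < 32)
    (ht : (t : ℤ) = a + 12 + 32 * (b + 12)) :
    evalA (cnt 12 a b) (treeP 12 11 1 11 1) = bl 1 12 t - bl 2 6 t - bl 3 4 t + bl 6 2 t := by
  rw [tree12, evalA_cons, evalA_cons, evalA_cons, evalA_cons]
  dsimp only
  rw [cnt_block 12 2 6 _ rfl (by norm_num) (by norm_num) a b t ha ha' ht (by decide +kernel) (by decide +kernel),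
    cnt_block 12 4 3 _ rfl (by norm_num) (by norm_num) a b t ha ha' ht (by decide +kernel) (by decide +kernel),
    cnt_block 12 6 2 _ rfl (by norm_num) (by norm_num) a b t ha ha' ht (by decide +kernel) (by decide +kernel),
    cnt_block 12 12 1 _ rfl (by norm_num) (by norm_num) a b t ha ha' ht (by decide +kernel) (by decide +kernel)]
  simp only [evalA, bl, List.map_nil, List.sum_nil]
  ring

section
variable (H1 H2 : LieDerivation ℂ FL FL)
    (h1 : ∀ i, H1 (FreeLieAlgebra.of ℂ i) = (w1 i : ℂ) • FreeLieAlgebra.of ℂ i)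
    (h2 : ∀ i, H2 (FreeLieAlgebra.of ℂ i) = (w2 i : ℂ) • FreeLieAlgebra.of ℂ i)
include h1 h2

lemma dim_int (n : ℕ) (hn : n < 16) (a b : ℤ) :
    ((n + 1 : ℕ) : ℤ) * (Module.finrank ℂ (wtsp2 H1 H2 (n + 1) a b) : ℤ) =
      evalA (cnt (n + 1) a b) (treeP (n + 1) n 1 n 1) := by
  have h := (dim_formula H1 H2 h1 h2 (Nat.succ_ne_zero n) a b).2
  rw [sum_cf n hn a b] at h
  exact_mod_cast h

lemma dim3 (a b : ℤ) (t : ℕ) (r : ℤ) (ha : 0 ≤ a + 3) (ha' : a + 3 < 32)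
    (ht : (t : ℤ) = a + 3 + 32 * (b + 3)) (hr : bl 1 3 t - bl 3 1 t = 3 * r) :
    (Module.finrank ℂ (wtsp2 H1 H2 3 a b) : ℤ) = r := by
  have h := dim_int H1 H2 h1 h2 2 (by norm_num) a b
  have := h.trans ((cval3 a b t ha ha' ht).trans hr)
  push_cast at this
  linarith

lemma dim6 (a b : ℤ) (t : ℕ) (r : ℤ) (ha : 0 ≤ a + 6) (ha' : a + 6 < 32)
    (ht : (t : ℤ) = a + 6 + 32 * (b + 6))
    (hr : bl 1 6 t - bl 2 3 t - bl 3 2 t + bl 6 1 t = 6 * r) :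
    (Module.finrank ℂ (wtsp2 H1 H2 6 a b) : ℤ) = r := by
  have h := dim_int H1 H2 h1 h2 5 (by norm_num) a b
  have := h.trans ((cval6 a b t ha ha' ht).trans hr)
  push_cast at this
  linarith

lemma dim12 (a b : ℤ) (t : ℕ) (r : ℤ) (ha : 0 ≤ a + 12) (ha' : a + 12 < 32)
    (ht : (t : ℤ) = a + 12 + 32 * (b + 12))
    (hr : bl 1 12 t - bl 2 6 t - bl 3 4 t + bl 6 2 t = 12 * r) :
    (Module.finrank ℂ (wtsp2 H1 H2 12 a b) : ℤ) = r := by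
  have h := dim_int H1 H2 h1 h2 11 (by norm_num) a b
  have := h.trans ((cval12 a b t ha ha' ht).trans hr)
  push_cast at this
  linarith

lemma alt3 : (Module.finrank ℂ (wtsp2 H1 H2 3 0 0) : ℤ) - Module.finrank ℂ (wtsp2 H1 H2 3 2 (-1))
      - Module.finrank ℂ (wtsp2 H1 H2 3 1 1) + Module.finrank ℂ (wtsp2 H1 H2 3 3 0)
      + Module.finrank ℂ (wtsp2 H1 H2 3 0 3) - Module.finrank ℂ (wtsp2 H1 H2 3 2 2) = 0 := by
  rw [dim3 H1 H2 h1 h2 0 0 99 2 (by norm_num) (by norm_num) (by norm_num) (by decide +kernel),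
    dim3 H1 H2 h1 h2 2 (-1) 69 1 (by norm_num) (by norm_num) (by norm_num) (by decide +kernel),
    dim3 H1 H2 h1 h2 1 1 132 1 (by norm_num) (by norm_num) (by norm_num) (by decide +kernel),
    dim3 H1 H2 h1 h2 3 0 102 0 (by norm_num) (by norm_num) (by norm_num) (by decide +kernel),
    dim3 H1 H2 h1 h2 0 3 195 0 (by norm_num) (by norm_num) (by norm_num) (by decide +kernel),
    dim3 H1 H2 h1 h2 2 2 165 0 (by norm_num) (by norm_num) (by norm_num) (by decide +kernel)]
  norm_num

lemma alt6 : (Module.finrank ℂ (wtsp2 H1 H2 6 0 0) : ℤ) - Module.finrank ℂ (wtsp2 H1 H2 6 2 (-1))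
      - Module.finrank ℂ (wtsp2 H1 H2 6 1 1) + Module.finrank ℂ (wtsp2 H1 H2 6 3 0)
      + Module.finrank ℂ (wtsp2 H1 H2 6 0 3) - Module.finrank ℂ (wtsp2 H1 H2 6 2 2) = 0 := by
  rw [dim6 H1 H2 h1 h2 0 0 198 14 (by norm_num) (by norm_num) (by norm_num) (by decide +kernel),
    dim6 H1 H2 h1 h2 2 (-1) 168 10 (by norm_num) (by norm_num) (by norm_num) (by decide +kernel),
    dim6 H1 H2 h1 h2 1 1 231 10 (by norm_num) (by norm_num) (by norm_num) (by decide +kernel),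
    dim6 H1 H2 h1 h2 3 0 201 5 (by norm_num) (by norm_num) (by norm_num) (by decide +kernel),
    dim6 H1 H2 h1 h2 0 3 294 3 (by norm_num) (by norm_num) (by norm_num) (by decide +kernel),
    dim6 H1 H2 h1 h2 2 2 264 2 (by norm_num) (by norm_num) (by norm_num) (by decide +kernel)]
  norm_num

lemma alt12 :
    (Module.finrank ℂ (wtsp2 H1 H2 12 0 0) : ℤ) - Module.finrank ℂ (wtsp2 H1 H2 12 2 (-1))
      - Module.finrank ℂ (wtsp2 H1 H2 12 1 1) + Module.finrank ℂ (wtsp2 H1 H2 12 3 0)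
      + Module.finrank ℂ (wtsp2 H1 H2 12 0 3) - Module.finrank ℂ (wtsp2 H1 H2 12 2 2) = 35 := by
  rw [dim12 H1 H2 h1 h2 0 0 396 2880 (by norm_num) (by norm_num) (by norm_num) (by decide +kernel),
    dim12 H1 H2 h1 h2 2 (-1) 366 2310 (by norm_num) (by norm_num) (by norm_num) (by decide +kernel),
    dim12 H1 H2 h1 h2 1 1 429 2310 (by norm_num) (by norm_num) (by norm_num) (by decide +kernel),
    dim12 H1 H2 h1 h2 3 0 399 1539 (by norm_num) (by norm_num) (by norm_num) (by decide +kernel),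
    dim12 H1 H2 h1 h2 0 3 492 1386 (by norm_num) (by norm_num) (by norm_num) (by decide +kernel),
    dim12 H1 H2 h1 h2 2 2 462 1150 (by norm_num) (by norm_num) (by norm_num) (by decide +kernel)]
  norm_num

end
end SL

namespace SL

lemma deriv_zero (E : LieDerivation ℂ FL FL) (hE : ∀ i, E (FreeLieAlgebra.of ℂ i) = 0)
    {n : ℕ} {u : FL} (hu : u ∈ homog n) : E u = 0 := by
  have key : ∀ t : FreeMagma (Fin 3), E (magmaToLie t) = 0 := by
    intro t
    induction t with
    | ih1 j => exact hE j
    | ih2 u v hu hv =>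
      change E ⁅magmaToLie u, magmaToLie v⁆ = 0
      rw [LieDerivation.apply_lie_eq_add, hu, hv, lie_zero, zero_lie, add_zero]
  induction hu using Submodule.span_induction with
  | mem x hx => obtain ⟨t, _, rfl⟩ := hx; exact key t
  | zero => simp
  | add x y _ _ hx hy => rw [map_add, hx, hy, add_zero]
  | smul c x _ hx => rw [map_smul, hx, smul_zero]

lemma rel_homog (D1 D2 D3 : LieDerivation ℂ FL FL)
    (h : ∀ i : Fin 3, D1 (D2 (FreeLieAlgebra.of ℂ i)) =
      D2 (D1 (FreeLieAlgebra.of ℂ i)) + D3 (FreeLieAlgebra.of ℂ i))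
    {n : ℕ} {u : FL} (hu : u ∈ homog n) : D1 (D2 u) = D2 (D1 u) + D3 u := by
  have := deriv_zero (⁅D1, D2⁆ - D3) (fun i => by
    rw [LieDerivation.sub_apply, LieDerivation.commutator_apply, h i]; abel) hu
  rw [LieDerivation.sub_apply, LieDerivation.commutator_apply, sub_sub, sub_eq_zero] at this
  exact this

lemma lie_mem_homog {m n : ℕ} {u v : FL} (hu : u ∈ homog m) (hv : v ∈ homog n) :
    ⁅u, v⁆ ∈ homog (m + n) := by
  induction hu using Submodule.span_induction with
  | mem x hx =>
    obtain ⟨t, ht, rfl⟩ := hx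
    induction hv using Submodule.span_induction with
    | mem y hy =>
      obtain ⟨s, hs, rfl⟩ := hy
      refine Submodule.subset_span ⟨.mul t s, ?_, rfl⟩
      change t.length + s.length = m + n
      rw [show t.length = m from ht, show s.length = n from hs]
    | zero => simp
    | add x y _ _ hx hy => rw [lie_add]; exact add_mem hx hy
    | smul c x _ hx => rw [lie_smul]; exact Submodule.smul_mem _ _ hx
  | zero => simp
  | add x y _ _ hx hy => rw [add_lie]; exact add_mem hx hy
  | smul c x _ hx => rw [smul_lie]; exact Submodule.smul_mem _ _ hx

lemma magma_mem (t : FreeMagma (Fin 3)) : magmaToLie t ∈ homog t.length :=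
  Submodule.subset_span ⟨t, rfl, rfl⟩

lemma deriv_homog (D : LieDerivation ℂ FL FL)
    (hD : ∀ i, D (FreeLieAlgebra.of ℂ i) ∈ homog 1) (n : ℕ) :
    ∀ u ∈ homog n, D.toLinearMap u ∈ homog n := by
  have key : ∀ t : FreeMagma (Fin 3), D (magmaToLie t) ∈ homog t.length := by
    intro t
    induction t with
    | ih1 j => exact hD j
    | ih2 u v hu hv =>
      change D ⁅magmaToLie u, magmaToLie v⁆ ∈ homog (u.length + v.length)
      rw [LieDerivation.apply_lie_eq_add]
      exact add_mem (lie_mem_homog (magma_mem u) hv) (lie_mem_homog hu (magma_mem v))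
  intro u hu
  change D u ∈ homog n
  induction hu using Submodule.span_induction with
  | mem x hx =>
    obtain ⟨t, ht, rfl⟩ := hx
    have := key t
    rwa [show t.length = n from ht] at this
  | zero => simp
  | add x y _ _ hx hy => rw [map_add]; exact add_mem hx hy
  | smul c x _ hx => rw [map_smul]; exact Submodule.smul_mem _ _ hx

lemma homog_zero : homog 0 = ⊥ := by
  rw [homog, Submodule.span_eq_bot]
  rintro x ⟨t, ht, rfl⟩
  have := FreeMagma.length_pos t
  rw [show t.length = 0 from ht] at this
  omega

lemma magma_finite (n : ℕ) : {t : FreeMagma (Fin 3) | t.length ≤ n}.Finite := by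
  induction n with
  | zero =>
    convert Set.finite_empty (α := FreeMagma (Fin 3))
    ext t
    have := FreeMagma.length_pos t
    simp; omega
  | succ n ih =>
    refine ((Set.finite_range (FreeMagma.of : Fin 3 → _)).union
      (Set.Finite.image2 (fun a b => FreeMagma.mul a b) ih ih)).subset ?_
    intro t ht
    cases t with
    | of i => exact Or.inl ⟨i, rfl⟩
    | mul u v =>
      have h : u.length + v.length ≤ n + 1 := ht
      have h1 := FreeMagma.length_pos u
      have h2 := FreeMagma.length_pos v
      exact Or.inr ⟨u, by simp; omega, v, by simp; omega, rfl⟩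

lemma homog_fd (n : ℕ) : FiniteDimensional ℂ (homog n) := by
  apply FiniteDimensional.span_of_finite
  exact ((magma_finite n).subset (fun t ht => le_of_eq ht)).image _

/-- scaling automorphism -/
def scal (z : ℂ) : FL →ₗ⁅ℂ⁆ FL := FreeLieAlgebra.lift ℂ (fun i => z • FreeLieAlgebra.of ℂ i)

lemma scal_homog (z : ℂ) {n : ℕ} {u : FL} (hu : u ∈ homog n) : scal z u = z ^ n • u := by
  have key : ∀ t : FreeMagma (Fin 3), scal z (magmaToLie t) = z ^ t.length • magmaToLie t := by
    intro t
    induction t with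
    | ih1 j => simp [scal, magmaToLie, FreeMagma.length]
    | ih2 u v hu hv =>
      change scal z ⁅magmaToLie u, magmaToLie v⁆ =
        z ^ (u.length + v.length) • ⁅magmaToLie u, magmaToLie v⁆
      rw [LieHom.map_lie, hu, hv, smul_lie, lie_smul, smul_smul, pow_add]
  induction hu using Submodule.span_induction with
  | mem x hx => obtain ⟨t, ht, rfl⟩ := hx; rw [key, show t.length = n from ht]
  | zero => simp
  | add x y _ _ hx hy => rw [map_add, hx, hy, smul_add]
  | smul c x _ hx => rw [map_smul, hx, smul_comm]

/-- fixed points of the scaling map -/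
def fixS (z : ℂ) : LieSubalgebra ℂ FL where
  carrier := {u | scal z u = u}
  add_mem' := by intro a b ha hb; simp only [Set.mem_ofPred_eq] at *; rw [map_add, ha, hb]
  zero_mem' := by simp
  smul_mem' := by intro c a ha; simp only [Set.mem_ofPred_eq] at *; rw [map_smul, ha]
  lie_mem' := by
    intro a b ha hb
    have ha' : scal z a = a := ha
    have hb' : scal z b = b := hb
    change scal z ⁅a, b⁆ = ⁅a, b⁆
    rw [LieHom.map_lie, ha', hb']

lemma mem_fixS {z : ℂ} {u : FL} : u ∈ fixS z ↔ scal z u = u := Iff.rfl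

/-- The derivations have the prescribed values. -/
structure Gen (X1 X2 X3 H1 H2 Y1 Y2 Y3 : LieDerivation ℂ FL FL) : Prop where
    hX1a : X1 (FreeLieAlgebra.of ℂ 0) = 0
    hX1b : X1 (FreeLieAlgebra.of ℂ 1) = FreeLieAlgebra.of ℂ 0
    hX1c : X1 (FreeLieAlgebra.of ℂ 2) = 0
    hX2a : X2 (FreeLieAlgebra.of ℂ 0) = 0
    hX2b : X2 (FreeLieAlgebra.of ℂ 1) = 0
    hX2c : X2 (FreeLieAlgebra.of ℂ 2) = FreeLieAlgebra.of ℂ 1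
    hX3a : X3 (FreeLieAlgebra.of ℂ 0) = 0
    hX3b : X3 (FreeLieAlgebra.of ℂ 1) = 0
    hX3c : X3 (FreeLieAlgebra.of ℂ 2) = FreeLieAlgebra.of ℂ 0
    hH1a : H1 (FreeLieAlgebra.of ℂ 0) = FreeLieAlgebra.of ℂ 0
    hH1b : H1 (FreeLieAlgebra.of ℂ 1) = -FreeLieAlgebra.of ℂ 1
    hH1c : H1 (FreeLieAlgebra.of ℂ 2) = 0
    hH2a : H2 (FreeLieAlgebra.of ℂ 0) = 0
    hH2b : H2 (FreeLieAlgebra.of ℂ 1) = FreeLieAlgebra.of ℂ 1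
    hH2c : H2 (FreeLieAlgebra.of ℂ 2) = -FreeLieAlgebra.of ℂ 2
    hY1a : Y1 (FreeLieAlgebra.of ℂ 0) = FreeLieAlgebra.of ℂ 1
    hY1b : Y1 (FreeLieAlgebra.of ℂ 1) = 0
    hY1c : Y1 (FreeLieAlgebra.of ℂ 2) = 0
    hY2a : Y2 (FreeLieAlgebra.of ℂ 0) = 0
    hY2b : Y2 (FreeLieAlgebra.of ℂ 1) = FreeLieAlgebra.of ℂ 2
    hY2c : Y2 (FreeLieAlgebra.of ℂ 2) = 0
    hY3a : Y3 (FreeLieAlgebra.of ℂ 0) = FreeLieAlgebra.of ℂ 2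
    hY3b : Y3 (FreeLieAlgebra.of ℂ 1) = 0
    hY3c : Y3 (FreeLieAlgebra.of ℂ 2) = 0

lemma forall3 {p : Fin 3 → Prop} (h0 : p 0) (h1 : p 1) (h2 : p 2) : ∀ i, p i := by
  intro i; fin_cases i
  · exact h0
  · exact h1
  · exact h2

lemma of_mem (i : Fin 3) : FreeLieAlgebra.of ℂ i ∈ homog 1 :=
  Submodule.subset_span ⟨.of i, rfl, rfl⟩

section
variable {X1 X2 X3 H1 H2 Y1 Y2 Y3 : LieDerivation ℂ FL FL}

lemma Gen.wH1 (G : Gen X1 X2 X3 H1 H2 Y1 Y2 Y3) :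
    ∀ i, H1 (FreeLieAlgebra.of ℂ i) = (w1 i : ℂ) • FreeLieAlgebra.of ℂ i := by
  apply forall3
  · simp [G.hH1a, w1]
  · simp [G.hH1b, w1]
  · simp [G.hH1c, w1]

lemma Gen.wH2 (G : Gen X1 X2 X3 H1 H2 Y1 Y2 Y3) :
    ∀ i, H2 (FreeLieAlgebra.of ℂ i) = (w2 i : ℂ) • FreeLieAlgebra.of ℂ i := by
  apply forall3
  · simp [G.hH2a, w2]
  · simp [G.hH2b, w2]
  · simp [G.hH2c, w2]

/-- Restriction of a derivation. -/
def res (D : LieDerivation ℂ FL FL) (n : ℕ) (h : ∀ u ∈ homog n, D.toLinearMap u ∈ homog n) :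
    Module.End ℂ (homog n) := D.toLinearMap.restrict h

lemma res_coe (D : LieDerivation ℂ FL FL) (n : ℕ) (h : ∀ u ∈ homog n, D.toLinearMap u ∈ homog n)
    (v : homog n) : (res D n h v : FL) = D (v : FL) := rfl

lemma Gen.main (G : Gen X1 X2 X3 H1 H2 Y1 Y2 Y3) (n : ℕ) :
    FiniteDimensional ℂ (invariants3 X1 X2 X3 H1 H2 Y1 Y2 Y3 n) ∧
    (Module.finrank ℂ (invariants3 X1 X2 X3 H1 H2 Y1 Y2 Y3 n) : ℤ) =
      (Module.finrank ℂ (wtsp2 H1 H2 n 0 0) : ℤ) - Module.finrank ℂ (wtsp2 H1 H2 n 2 (-1))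
      - Module.finrank ℂ (wtsp2 H1 H2 n 1 1) + Module.finrank ℂ (wtsp2 H1 H2 n 3 0)
      + Module.finrank ℂ (wtsp2 H1 H2 n 0 3) - Module.finrank ℂ (wtsp2 H1 H2 n 2 2) := by
  have hfd := homog_fd n
  have x1 := deriv_homog X1 (forall3 (by simp [G.hX1a]) (by simp [G.hX1b, of_mem]) (by simp [G.hX1c])) n
  have x2 := deriv_homog X2 (forall3 (by simp [G.hX2a]) (by simp [G.hX2b]) (by simp [G.hX2c, of_mem])) n
  have x3 := deriv_homog X3 (forall3 (by simp [G.hX3a]) (by simp [G.hX3b]) (by simp [G.hX3c, of_mem])) n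
  have h1 := deriv_homog H1 (forall3 (by simp [G.hH1a, of_mem]) (by simp [G.hH1b, of_mem]) (by simp [G.hH1c])) n
  have h2 := deriv_homog H2 (forall3 (by simp [G.hH2a]) (by simp [G.hH2b, of_mem]) (by simp [G.hH2c, of_mem])) n
  have y1 := deriv_homog Y1 (forall3 (by simp [G.hY1a, of_mem]) (by simp [G.hY1b]) (by simp [G.hY1c])) n
  have y2 := deriv_homog Y2 (forall3 (by simp [G.hY2a]) (by simp [G.hY2b, of_mem]) (by simp [G.hY2c])) n
  have y3 := deriv_homog Y3 (forall3 (by simp [G.hY3a, of_mem]) (by simp [G.hY3b]) (by simp [G.hY3c])) n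
  have key : ∀ D1 D2 D3 : LieDerivation ℂ FL FL, (∀ i : Fin 3, D1 (D2 (FreeLieAlgebra.of ℂ i)) =
      D2 (D1 (FreeLieAlgebra.of ℂ i)) + D3 (FreeLieAlgebra.of ℂ i)) →
      ∀ v : homog n, D1 (D2 (v : FL)) = D2 (D1 (v : FL)) + D3 (v : FL) :=
    fun D1 D2 D3 h v => rel_homog D1 D2 D3 h v.2
  obtain ⟨hX1a, hX1b, hX1c, hX2a, hX2b, hX2c, hX3a, hX3b, hX3c, hH1a, hH1b, hH1c, hH2a, hH2b, hH2c,
    hY1a, hY1b, hY1c, hY2a, hY2b, hY2c, hY3a, hY3b, hY3c⟩ := G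
  have R : Rel (res X1 n x1) (res X2 n x2) (res X3 n x3) (res H1 n h1) (res H2 n h2)
      (res Y1 n y1) (res Y2 n y2) (res Y3 n y3) := by
    constructor <;> intro v <;> apply Subtype.ext <;>
      simp only [Submodule.coe_add, Submodule.coe_sub, Submodule.coe_smul, res_coe]
    · exact key X1 X2 X3 (forall3 (by simp [*]) (by simp [*]) (by simp [*])) v
    · simpa using key X1 X3 0 (forall3 (by simp [*]) (by simp [*]) (by simp [*])) v
    · simpa using key X2 X3 0 (forall3 (by simp [*]) (by simp [*]) (by simp [*])) v
    · simpa [sub_eq_add_neg] using key Y1 Y2 (-Y3) (forall3 (by simp [*]) (by simp [*]) (by simp [*])) v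
    · simpa using key Y1 Y3 0 (forall3 (by simp [*]) (by simp [*]) (by simp [*])) v
    · simpa using key Y2 Y3 0 (forall3 (by simp [*]) (by simp [*]) (by simp [*])) v
    · simpa using key X1 Y1 H1 (forall3 (by simp [*]) (by simp [*]) (by simp [*])) v
    · simpa using key X2 Y2 H2 (forall3 (by simp [*]) (by simp [*]) (by simp [*])) v
    · simpa using key X3 Y3 (H1 + H2) (forall3 (by simp [*]) (by simp [*]) (by simp [*])) v
    · simpa using key X1 Y2 0 (forall3 (by simp [*]) (by simp [*]) (by simp [*])) v
    · simpa using key X2 Y1 0 (forall3 (by simp [*]) (by simp [*]) (by simp [*])) v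
    · simpa [sub_eq_add_neg] using key X1 Y3 (-Y2) (forall3 (by simp [*]) (by simp [*]) (by simp [*])) v
    · simpa using key X2 Y3 Y1 (forall3 (by simp [*]) (by simp [*]) (by simp [*])) v
    · simpa [sub_eq_add_neg] using key X3 Y1 (-X2) (forall3 (by simp [*]) (by simp [*]) (by simp [*])) v
    · simpa using key X3 Y2 X1 (forall3 (by simp [*]) (by simp [*]) (by simp [*])) v
    · simpa using key H1 X1 ((2 : ℂ) • X1) (forall3 (by simp [*]) (by simp [*, two_smul]) (by simp [*])) v
    · simpa [sub_eq_add_neg] using key H1 X2 (-X2) (forall3 (by simp [*]) (by simp [*]) (by simp [*])) v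
    · simpa using key H1 X3 X3 (forall3 (by simp [*]) (by simp [*]) (by simp [*])) v
    · simpa [sub_eq_add_neg] using key H2 X1 (-X1) (forall3 (by simp [*]) (by simp [*]) (by simp [*])) v
    · simpa using key H2 X2 ((2 : ℂ) • X2) (forall3 (by simp [*]) (by simp [*]) (by simp [*, two_smul])) v
    · simpa using key H2 X3 X3 (forall3 (by simp [*]) (by simp [*]) (by simp [*])) v
    · simpa [sub_eq_add_neg] using key H1 Y1 (-((2 : ℂ) • Y1)) (forall3 (by simp [*, two_smul]) (by simp [*]) (by simp [*])) v
    · simpa using key H1 Y2 Y2 (forall3 (by simp [*]) (by simp [*]) (by simp [*])) v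
    · simpa [sub_eq_add_neg] using key H1 Y3 (-Y3) (forall3 (by simp [*]) (by simp [*]) (by simp [*])) v
    · simpa using key H2 Y1 Y1 (forall3 (by simp [*]) (by simp [*]) (by simp [*])) v
    · simpa [sub_eq_add_neg] using key H2 Y2 (-((2 : ℂ) • Y2)) (forall3 (by simp [*]) (by simp [*, two_smul]) (by simp [*])) v
    · simpa [sub_eq_add_neg] using key H2 Y3 (-Y3) (forall3 (by simp [*]) (by simp [*]) (by simp [*])) v
  have hw : ∀ a b : ℤ, Module.finrank ℂ (wt (res H1 n h1) (res H2 n h2) a b) =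
      Module.finrank ℂ (wtsp2 H1 H2 n a b) := by
    intro a b
    have : wtsp2 H1 H2 n a b = (wt (res H1 n h1) (res H2 n h2) a b).map (homog n).subtype := by
      ext u
      rw [mem_wtsp2, Submodule.mem_map]
      constructor
      · rintro ⟨hu, e1, e2⟩
        exact ⟨⟨u, hu⟩, mem_wt.2 ⟨Subtype.ext e1, Subtype.ext e2⟩, rfl⟩
      · rintro ⟨v, hv, rfl⟩
        obtain ⟨e1, e2⟩ := mem_wt.1 hv
        exact ⟨v.2, congrArg Subtype.val e1, congrArg Subtype.val e2⟩
    rw [this]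
    exact (LinearEquiv.finrank_eq (Submodule.equivMapOfInjective _ (Submodule.injective_subtype _) _))
  have hi : invariants3 X1 X2 X3 H1 H2 Y1 Y2 Y3 n =
      (LinearMap.ker (res X1 n x1) ⊓ LinearMap.ker (res X2 n x2) ⊓ LinearMap.ker (res X3 n x3) ⊓
        LinearMap.ker (res H1 n h1) ⊓ LinearMap.ker (res H2 n h2) ⊓ LinearMap.ker (res Y1 n y1) ⊓
        LinearMap.ker (res Y2 n y2) ⊓ LinearMap.ker (res Y3 n y3)).map (homog n).subtype := by
    ext u
    simp only [invariants3, Submodule.mem_inf, Submodule.mem_map, LinearMap.mem_ker, and_assoc]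
    constructor
    · rintro ⟨hu, e1, e2, e3, e4, e5, e6, e7, e8⟩
      exact ⟨⟨u, hu⟩, Subtype.ext e1, Subtype.ext e2, Subtype.ext e3, Subtype.ext e4, Subtype.ext e5,
        Subtype.ext e6, Subtype.ext e7, Subtype.ext e8, rfl⟩
    · rintro ⟨v, e1, e2, e3, e4, e5, e6, e7, e8, rfl⟩
      exact ⟨v.2, congrArg Subtype.val e1, congrArg Subtype.val e2, congrArg Subtype.val e3,
        congrArg Subtype.val e4, congrArg Subtype.val e5, congrArg Subtype.val e6,
        congrArg Subtype.val e7, congrArg Subtype.val e8⟩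
  have hf := R.finrank_inv
  rw [hw, hw, hw, hw, hw, hw] at hf
  rw [hi]
  refine ⟨inferInstance, ?_⟩
  rw [← hf]
  congr 1
  exact (LinearEquiv.finrank_eq (Submodule.equivMapOfInjective _ (Submodule.injective_subtype _) _)).symm

lemma inv_le (n : ℕ) :
    invariants3 X1 X2 X3 H1 H2 Y1 Y2 Y3 n ≤ wtsp2 H1 H2 n 0 0 := by
  intro u hu
  simp only [invariants3, Submodule.mem_inf, LinearMap.mem_ker, and_assoc] at hu
  obtain ⟨h, -, -, -, h1, h2, -⟩ := hu
  rw [mem_wtsp2]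
  refine ⟨h, ?_, ?_⟩
  · rw [Int.cast_zero, zero_smul]; exact h1
  · rw [Int.cast_zero, zero_smul]; exact h2

lemma W_empty {n : ℕ} (h : ¬ 3 ∣ n) : IsEmpty (W n 0 0) := by
  constructor
  rintro ⟨f, h1, h2⟩
  apply h
  have h3 : (n : ℤ) = ∑ i, (w1 (f i) + 2 * w2 (f i) + 3 * (if f i = 2 then 1 else 0)) := by
    have : ∀ x : Fin 3, (w1 x + 2 * w2 x + 3 * (if x = 2 then 1 else 0)) = 1 := by
      decide
    rw [Finset.sum_congr rfl fun i _ => this (f i)]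
    simp
  rw [Finset.sum_add_distrib, Finset.sum_add_distrib, ← Finset.mul_sum, ← Finset.mul_sum, h1, h2] at h3
  omega

lemma Gen.inv_bot (G : Gen X1 X2 X3 H1 H2 Y1 Y2 Y3) (n : ℕ) (hn : n < 12) (h9 : n ≠ 9) :
    invariants3 X1 X2 X3 H1 H2 Y1 Y2 Y3 n = ⊥ := by
  by_cases h0 : n = 0
  · subst h0
    rw [eq_bot_iff, ← homog_zero]
    intro u hu
    exact ((mem_wtsp2 H1 H2).1 (inv_le 0 hu)).1
  by_cases h3 : 3 ∣ n
  · obtain ⟨hf, hd⟩ := G.main n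
    have : n = 3 ∨ n = 6 := by omega
    apply Submodule.finrank_eq_zero.1
    rcases this with rfl | rfl
    · rw [alt3 H1 H2 G.wH1 G.wH2] at hd
      exact_mod_cast hd
    · rw [alt6 H1 H2 G.wH1 G.wH2] at hd
      exact_mod_cast hd
  · have := W_empty h3
    obtain ⟨hf, hd⟩ := dim_formula H1 H2 G.wH1 G.wH2 h0 0 0
    rw [Finset.univ_eq_empty, Finset.sum_empty] at hd
    rw [eq_bot_iff]
    have h : Module.finrank ℂ (wtsp2 H1 H2 n 0 0) = 0 := by
      rcases mul_eq_zero.1 hd with h | h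
      · exact absurd (by exact_mod_cast h) h0
      · exact_mod_cast h
    rw [← Submodule.finrank_eq_zero.1 h]
    exact inv_le n

lemma Gen.prim (G : Gen X1 X2 X3 H1 H2 Y1 Y2 Y3) :
    invariants3 X1 X2 X3 H1 H2 Y1 Y2 Y3 12 ⊓
      (lowerInv3 X1 X2 X3 H1 H2 Y1 Y2 Y3 12).toSubmodule = ⊥ := by
  obtain ⟨z, hz⟩ : ∃ z : ℂ, IsPrimitiveRoot z 9 := ⟨_, Complex.isPrimitiveRoot_exp 9 (by norm_num)⟩
  have hle : lowerInv3 X1 X2 X3 H1 H2 Y1 Y2 Y3 12 ≤ fixS z := by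
    rw [lowerInv3, LieSubalgebra.lieSpan_le]
    intro u hu
    simp only [Set.mem_iUnion] at hu
    obtain ⟨i, hi, hu⟩ := hu
    change u ∈ invariants3 X1 X2 X3 H1 H2 Y1 Y2 Y3 i at hu
    by_cases h9 : i = 9
    · subst h9
      have := ((mem_wtsp2 H1 H2).1 (inv_le 9 hu)).1
      change scal z u = u
      rw [scal_homog z this, hz.pow_eq_one, one_smul]
    · rw [G.inv_bot i hi h9, Submodule.mem_bot] at hu
      rw [hu]
      exact (fixS z).zero_mem
  rw [eq_bot_iff]
  rintro u ⟨hu, hl⟩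
  have h1 := ((mem_wtsp2 H1 H2).1 (inv_le 12 hu)).1
  have h2 : scal z u = u := hle hl
  rw [scal_homog z h1] at h2
  rw [Submodule.mem_bot]
  have h3 : (z ^ 12 - 1) • u = 0 := by rw [sub_smul, h2, one_smul, sub_self]
  rcases smul_eq_zero.1 h3 with h | h
  · have := hz.dvd_of_pow_eq_one 12 (sub_eq_zero.1 h)
    omega
  · exact h

lemma Gen.dim (G : Gen X1 X2 X3 H1 H2 Y1 Y2 Y3) :
    Module.rank ℂ (invariants3 X1 X2 X3 H1 H2 Y1 Y2 Y3 12) = 35 := by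
  obtain ⟨hf, hd⟩ := G.main 12
  rw [alt12 H1 H2 G.wH1 G.wH2] at hd
  have : Module.finrank ℂ (invariants3 X1 X2 X3 H1 H2 Y1 Y2 Y3 12) = 35 := by exact_mod_cast hd
  rw [← Module.finrank_eq_rank, this]
  norm_num

end
end SL


/-- For the natural representation of sl₃(ℂ) on the free Lie algebra on `a, b, c`, the
space of Lie invariants of degree 12 has dimension 35, and every Lie invariant of
degree 12 is primitive: the space of invariants of degree 12 meets the Lie subalgebra
generated by the invariants of degree `< 12` only in `0`. -/
theorem sl3_invariants_degree_twelve
    (X1 X2 X3 H1 H2 Y1 Y2 Y3 : LieDerivation ℂ FL FL)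
    (hX1a : X1 genA = 0) (hX1b : X1 genB = genA) (hX1c : X1 genC = 0)
    (hX2a : X2 genA = 0) (hX2b : X2 genB = 0) (hX2c : X2 genC = genB)
    (hX3a : X3 genA = 0) (hX3b : X3 genB = 0) (hX3c : X3 genC = genA)
    (hH1a : H1 genA = genA) (hH1b : H1 genB = -genB) (hH1c : H1 genC = 0)
    (hH2a : H2 genA = 0) (hH2b : H2 genB = genB) (hH2c : H2 genC = -genC)
    (hY1a : Y1 genA = genB) (hY1b : Y1 genB = 0) (hY1c : Y1 genC = 0)
    (hY2a : Y2 genA = 0) (hY2b : Y2 genB = genC) (hY2c : Y2 genC = 0)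
    (hY3a : Y3 genA = genC) (hY3b : Y3 genB = 0) (hY3c : Y3 genC = 0) :
    Module.rank ℂ ↥(invariants3 X1 X2 X3 H1 H2 Y1 Y2 Y3 12) = 35 ∧
    invariants3 X1 X2 X3 H1 H2 Y1 Y2 Y3 12 ⊓
      (lowerInv3 X1 X2 X3 H1 H2 Y1 Y2 Y3 12).toSubmodule = ⊥ := by
  exact ⟨SL.Gen.dim ⟨hX1a, hX1b, hX1c, hX2a, hX2b, hX2c, hX3a, hX3b, hX3c, hH1a, hH1b, hH1c,
      hH2a, hH2b, hH2c, hY1a, hY1b, hY1c, hY2a, hY2b, hY2c, hY3a, hY3b, hY3c⟩,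
    SL.Gen.prim ⟨hX1a, hX1b, hX1c, hX2a, hX2b, hX2c, hX3a, hX3b, hX3c, hH1a, hH1b, hH1c,
      hH2a, hH2b, hH2c, hY1a, hY1b, hY1c, hY2a, hY2b, hY2c, hY3a, hY3b, hY3c⟩⟩
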